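/- arXiv:1302.0829 — 8 statements merged into one kernel-verified Lean document; each statement's English description precedes it below -/
import Mathlib

section
/- Let K be a compact Hausdorff totally disconnected topological meet-semilattice with least element 0 and jointly continuous meet. For every p ∈ K, the principal filter [p,→) = {x ∈ K : p ≤ x} is a clopen subset of K if and only if p is a compact element of K. -/
/-- An element `p` of a partially ordered set is a *compact element* if for every
subset `A` of which `p` is a least upper bound there exists a finite subset `A₀ ⊆ A`
of which `p` is a least upper bound. -/
def CompactElem {K : Type*} [PartialOrder K] (p : K) : Prop :=
  ∀ A : Set K, IsLUB A p → ∃ A₀ : Finset K, (A₀ : Set K) ⊆ A ∧ IsLUB (A₀ : Set K) p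

/-- A nonempty compact set closed under meets has a least element. -/
theorem IsCompact.exists_isLeast_of_infClosed {K : Type*} [TopologicalSpace K]
    [SemilatticeInf K] [ClosedIicTopology K] {S : Set K} (hS : IsCompact S)
    (hne : S.Nonempty) (hinf : InfClosed S) : ∃ k, IsLeast S k := by
  obtain ⟨k, hk, hk'⟩ := hS.inter_iInter_nonempty (fun s : S => Set.Iic (s : K))
    (fun s => isClosed_Iic) (fun u => by
      classical
      induction u using Finset.induction_on with
      | empty => simpa using hne
      | insert a u _ ih =>
        obtain ⟨x, hx, hxu⟩ := ih
        simp only [Set.mem_iInter, Set.mem_Iic] at hxu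
        refine ⟨(a : K) ⊓ x, hinf a.2 hx, ?_⟩
        simp only [Set.mem_iInter, Set.mem_Iic, Finset.mem_insert]
        rintro i (rfl | hi)
        · exact inf_le_left
        · exact inf_le_right.trans (hxu i hi))
  refine ⟨k, hk, fun s hs => ?_⟩
  exact Set.mem_iInter.1 hk' ⟨s, hs⟩

/-- The elements carrying a clopen set `U` into itself under meet form a clopen set. -/
theorem IsClopen.setOf_forall_inf_mem {K : Type*} [TopologicalSpace K] [CompactSpace K]
    [SemilatticeInf K] [ContinuousInf K] {U : Set K} (hU : IsClopen U) :
    IsClopen {x : K | ∀ u ∈ U, x ⊓ u ∈ U} := by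
  constructor
  · simp only [Set.ofPred_forall]
    exact isClosed_iInter fun u => isClosed_iInter fun _ =>
      hU.isClosed.preimage (continuous_id.inf continuous_const)
  · rw [isOpen_iff_mem_nhds]
    intro x hx
    refine hU.isClosed.isCompact.eventually_forall_of_forall_eventually fun u hu => ?_
    exact (hU.isOpen.preimage continuous_inf).mem_nhds (hx u hu)

/-- In a compact zero-dimensional topological semilattice, `p ≰ y` is witnessed by an element
below `p` whose principal filter is clopen. -/
theorem exists_isClopen_Ici_of_not_le {K : Type*} [TopologicalSpace K] [CompactSpace K]
    [T2Space K] [TotallyDisconnectedSpace K] [SemilatticeInf K] [ContinuousInf K]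
    [OrderClosedTopology K] {p y : K} (h : ¬ p ≤ y) :
    ∃ k ≤ p, IsClopen (Set.Ici k) ∧ ¬ k ≤ y := by
  obtain ⟨V, hV, hpV, hVy⟩ := compact_exists_isClopen_in_isOpen
    (isClosed_Iic (a := y)).isOpen_compl (x := p) h
  let U : Set K := {x | p ⊓ x ∈ V}
  have hU : IsClopen U := hV.preimage (continuous_const.inf continuous_id)
  let S : Set K := {x | ∀ u ∈ U, x ⊓ u ∈ U}
  have hS : IsClopen S := hU.setOf_forall_inf_mem
  have hpS : p ∈ S := fun u hu => by
    change p ⊓ (p ⊓ u) ∈ V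
    rwa [inf_left_idem]
  have hSinf : InfClosed S := fun a ha b hb u hu => by
    rw [inf_assoc]
    exact ha _ (hb u hu)
  obtain ⟨k, hkS, hk⟩ := hS.isClosed.isCompact.exists_isLeast_of_infClosed ⟨p, hpS⟩ hSinf
  have hkp : k ≤ p := hk hpS
  refine ⟨k, hkp, ?_, ?_⟩
  · have hIci : Set.Ici k = (fun x => x ⊓ k) ⁻¹' S := by
      ext x
      refine ⟨fun hx => ?_, fun hx => (hk hx).trans inf_le_left⟩
      change x ⊓ k ∈ S
      rwa [inf_eq_right.2 hx]
    rw [hIci]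
    exact hS.preimage (continuous_id.inf continuous_const)
  · have hpU : p ∈ U := by
      change p ⊓ p ∈ V
      rwa [inf_idem]
    have hkV : p ⊓ (k ⊓ p) ∈ V := hkS p hpU
    rw [inf_eq_left.2 hkp, inf_eq_right.2 hkp] at hkV
    exact hVy hkV

/-- An element of a compact ordered space with clopen principal filter is compact. -/
theorem CompactElem.of_isClopen_Ici {K : Type*} [TopologicalSpace K] [CompactSpace K]
    [PartialOrder K] [ClosedIciTopology K] {p : K} (hp : IsClopen (Set.Ici p)) :
    CompactElem p := by
  classical
  intro A hA
  by_contra! hcon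
  obtain ⟨z, hz, hzA⟩ := hp.compl.isClosed.isCompact.inter_iInter_nonempty
    (fun a : A => Set.Ici (a : K)) (fun a => isClosed_Ici) (fun u => by
      have hsub : ((u.image Subtype.val : Finset K) : Set K) ⊆ A := by
        intro x hx
        obtain ⟨a, _, rfl⟩ := Finset.mem_image.1 hx
        exact a.2
      have hlub := hcon _ hsub
      have hup : p ∈ upperBounds ((u.image Subtype.val : Finset K) : Set K) :=
        fun x hx => hA.1 (hsub hx)
      have hnot : ¬ p ∈ lowerBounds (upperBounds ((u.image Subtype.val : Finset K) : Set K)) :=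
        fun hlow => hlub ⟨hup, hlow⟩
      simp only [mem_lowerBounds, not_forall] at hnot
      obtain ⟨z, hz, hpz⟩ := hnot
      refine ⟨z, hpz, ?_⟩
      simp only [Set.mem_iInter, Set.mem_Ici]
      exact fun a ha => hz (Finset.mem_image_of_mem Subtype.val ha))
  exact hz (hA.2 fun a ha => Set.mem_iInter.1 hzA ⟨a, ha⟩)

/-- In a compact Hausdorff totally disconnected topological meet-semilattice with
least element `0` and jointly continuous meet, the principal filter `[p,→)` is
clopen if and only if `p` is a compact element. -/
theorem stmt0 {K : Type*} [TopologicalSpace K] [CompactSpace K] [T2Space K]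
    [TotallyDisconnectedSpace K] [SemilatticeInf K] [OrderBot K]
    (hmeet : Continuous fun x : K × K => x.1 ⊓ x.2) (p : K) :
    IsClopen (Set.Ici p) ↔ CompactElem p := by
  have : ContinuousInf K := ⟨hmeet⟩
  have : OrderClosedTopology K := ⟨by
    simp only [← inf_eq_left]
    exact isClosed_eq hmeet continuous_fst⟩
  refine ⟨CompactElem.of_isClopen_Ici, fun hp => ⟨isClosed_Ici, ?_⟩⟩
  have hlub : IsLUB {k | k ≤ p ∧ IsClopen (Set.Ici k)} p := by
    refine ⟨fun k hk => hk.1, fun y hy => ?_⟩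
    by_contra hpy
    obtain ⟨k, hkp, hk, hky⟩ := exists_isClopen_Ici_of_not_le hpy
    exact hky (hy ⟨hkp, hk⟩)
  obtain ⟨A, hA, hAp⟩ := hp _ hlub
  have hIci : Set.Ici p = ⋂ k ∈ A, Set.Ici k := by
    ext x
    simp only [Set.mem_Ici, Set.mem_iInter]
    exact isLUB_le_iff hAp
  rw [hIci]
  exact isOpen_biInter_finset fun k hk => (hA hk).2.isOpen
end

section
/- Let K be a compact Hausdorff totally disconnected topological meet-semilattice with least element 0 and jointly continuous meet. If A ⊆ K is a nonempty clopen set, then every minimal element of A is a compact element of K. -/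
/-- In a compact Hausdorff totally disconnected topological meet-semilattice with
least element `0` and jointly continuous meet, every minimal element of a nonempty
clopen set is a compact element. -/
theorem stmt3 {K : Type*} [TopologicalSpace K] [CompactSpace K] [T2Space K]
    [TotallyDisconnectedSpace K] [SemilatticeInf K] [OrderBot K]
    (hmeet : Continuous fun x : K × K => x.1 ⊓ x.2)
    (A : Set K) (hA : IsClopen A) (hne : A.Nonempty)
    (a : K) (ha : a ∈ A) (hmin : ∀ x ∈ A, ¬ x < a) :
    CompactElem a := by
  classical
  have : ContinuousInf K := ⟨hmeet⟩
  have hIci (b : K) : IsClosed (Set.Ici b) := by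
    have h : Set.Ici b = {x | b ⊓ x = b} := by ext x; simp
    rw [h]
    exact isClosed_eq (by fun_prop) continuous_const
  have hIic : IsClosed (Set.Iic a) := by
    have h : Set.Iic a = {x | x ⊓ a = x} := by ext x; simp
    rw [h]
    exact isClosed_eq (by fun_prop) continuous_id
  intro B hB
  by_contra! hfin
  obtain ⟨x, ⟨hxA, hxa⟩, hx⟩ :=
    (hA.compl.isClosed.inter hIic).isCompact.inter_iInter_nonempty
      (fun b : B => Set.Ici (b : K)) (fun b => hIci b) fun F => by
        have hsub : ((F.image Subtype.val : Finset K) : Set K) ⊆ B := by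
          intro b hb
          simp only [Finset.coe_image, Set.mem_image] at hb
          obtain ⟨c, -, rfl⟩ := hb
          exact c.2
        obtain ⟨u, hu, hau⟩ : ∃ u ∈ upperBounds ((F.image Subtype.val : Finset K) : Set K),
            ¬ a ≤ u := by
          by_contra! h
          exact hfin _ hsub ⟨fun b hb => hB.1 (hsub hb), h⟩
        refine ⟨u ⊓ a, ⟨fun h => hmin _ h (inf_lt_right.2 hau), inf_le_right⟩, ?_⟩
        refine Set.mem_iInter₂.2 fun b hb => le_inf (hu ?_) (hB.1 b.2)
        exact Finset.mem_coe.2 (Finset.mem_image_of_mem _ hb)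
  have hax : a ≤ x := hB.2 fun b hb => Set.mem_iInter.1 hx ⟨b, hb⟩
  exact hxA (le_antisymm hxa hax ▸ ha)
end

section
/- Let K be a compact Hausdorff topological space equipped with a meet-semilattice structure having a greatest element 1, such that the meet operation (x,y) ↦ x ⊓ y is jointly continuous. Then K is a complete lattice: every subset of K has an infimum and a supremum in K. Moreover, for every nonempty A ⊆ K, the net S ↦ inf S, indexed by the nonempty finite subsets S of A directed by inclusion, converges in K to inf A. -/
open Filter

/-- The net of finite meets of elements of `A`. -/
def finiteMeets {K : Type*} [SemilatticeInf K] (A : Set K)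
    (S : {S : Finset K // S.Nonempty ∧ (S : Set K) ⊆ A}) : K :=
  S.1.inf' S.2.1 id

theorem isGLB_of_clusterPt_finiteMeets {K : Type*} [TopologicalSpace K] [T2Space K]
    [SemilatticeInf K] (hmeet : Continuous fun x : K × K => x.1 ⊓ x.2) {A : Set K} {c : K}
    (hc : ClusterPt c (map (finiteMeets A) atTop)) : IsGLB A c := by
  have mem_of_eventually {t : Set K} (ht : IsClosed t)
      (h : ∀ᶠ S in atTop, finiteMeets A S ∈ t) : c ∈ t :=
    isClosed_iff_clusterPt.1 ht c (hc.mono (le_principal_iff.2 h))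
  constructor
  · intro a ha
    have hclosed : IsClosed {x : K | x ⊓ a = x} :=
      isClosed_eq (hmeet.comp (continuous_id.prodMk continuous_const)) continuous_id
    refine inf_eq_left.1 (mem_of_eventually (t := {x : K | x ⊓ a = x}) hclosed ?_)
    filter_upwards [eventually_ge_atTop
      (⟨{a}, by simp, by simpa using ha⟩ :
        {S : Finset K // S.Nonempty ∧ (S : Set K) ⊆ A})] with S hS
    exact inf_eq_left.2 (Finset.inf'_le id (hS (Finset.mem_singleton_self a)))
  · intro b hb
    have hclosed : IsClosed {x : K | b ⊓ x = b} :=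
      isClosed_eq (hmeet.comp (continuous_const.prodMk continuous_id)) continuous_const
    refine inf_eq_left.1 (mem_of_eventually (t := {x : K | b ⊓ x = b}) hclosed
      (Eventually.of_forall fun S => ?_))
    exact inf_eq_left.2 (Finset.le_inf' _ _ fun x hx => hb (S.2.2 hx))

theorem atTop_neBot_nonempty_finset_subsets {K : Type*} {A : Set K} (hA : A.Nonempty) :
    (atTop : Filter {S : Finset K // S.Nonempty ∧ (S : Set K) ⊆ A}).NeBot := by
  classical
  obtain ⟨a, ha⟩ := hA
  have : Nonempty {S : Finset K // S.Nonempty ∧ (S : Set K) ⊆ A} :=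
    ⟨⟨{a}, by simp, by simpa using ha⟩⟩
  refine atTop_neBot_iff.2 ⟨this, ⟨fun S T => ?_⟩⟩
  exact ⟨⟨S.1 ∪ T.1, S.2.1.mono Finset.subset_union_left,
      by simpa using ⟨S.2.2, T.2.2⟩⟩,
    Finset.subset_union_left, Finset.subset_union_right⟩

theorem exists_isGLB_of_continuous_inf {K : Type*} [TopologicalSpace K] [CompactSpace K]
    [T2Space K] [SemilatticeInf K] [OrderTop K]
    (hmeet : Continuous fun x : K × K => x.1 ⊓ x.2) (A : Set K) : ∃ i : K, IsGLB A i := by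
  rcases A.eq_empty_or_nonempty with rfl | hA
  · exact ⟨⊤, isGLB_empty⟩
  · have := atTop_neBot_nonempty_finset_subsets hA
    obtain ⟨c, hc⟩ := exists_clusterPt_of_compactSpace (map (finiteMeets A) atTop)
    exact ⟨c, isGLB_of_clusterPt_finiteMeets hmeet hc⟩

/-- A compact Hausdorff topological meet-semilattice with greatest element `1` and
jointly continuous meet is a complete lattice (every subset has an infimum and a
supremum), and for every nonempty `A ⊆ K` the net `S ↦ inf S`, indexed by the
nonempty finite subsets `S` of `A` directed by inclusion, converges to `inf A`. -/
theorem stmt4 {K : Type*} [TopologicalSpace K] [CompactSpace K] [T2Space K]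
    [SemilatticeInf K] [OrderTop K]
    (hmeet : Continuous fun x : K × K => x.1 ⊓ x.2) :
    (∀ A : Set K, ∃ i : K, IsGLB A i) ∧
    (∀ A : Set K, ∃ s : K, IsLUB A s) ∧
    (∀ A : Set K, A.Nonempty → ∀ i : K, IsGLB A i →
      Tendsto (fun S : {S : Finset K // S.Nonempty ∧ (S : Set K) ⊆ A} =>
          S.1.inf' S.2.1 id)
        atTop (nhds i)) := by
  refine ⟨exists_isGLB_of_continuous_inf hmeet, fun A => ?_, fun A _ i hi => ?_⟩
  · obtain ⟨s, hs⟩ := exists_isGLB_of_continuous_inf hmeet (upperBounds A)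
    exact ⟨s, isGLB_upperBounds.1 hs⟩
  · exact le_nhds_of_unique_clusterPt fun c hc =>
      (isGLB_of_clusterPt_finiteMeets hmeet hc).unique hi
end

section
/- Let K be a compact Hausdorff totally disconnected topological distributive lattice with least element 0 and greatest element 1 whose operations ⊓ and ⊔ are jointly continuous. Then for every a, b ∈ K with a ≰ b there exists a clopen prime filter P ⊆ K such that a ∈ P and b ∉ P. -/
/-- A *filter* in a lattice: for all `a, b ∈ F`, every `x` with `a ⊓ b ≤ x` belongs to `F`. -/
def IsLatFilter {K : Type*} [Lattice K] (F : Set K) : Prop :=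
  ∀ a ∈ F, ∀ b ∈ F, ∀ x : K, a ⊓ b ≤ x → x ∈ F

/-- An *ideal* in a lattice: for all `a, b ∈ I`, every `x` with `x ≤ a ⊔ b` belongs to `I`. -/
def IsLatIdeal {K : Type*} [Lattice K] (I : Set K) : Prop :=
  ∀ a ∈ I, ∀ b ∈ I, ∀ x : K, x ≤ a ⊔ b → x ∈ I

/-- A filter `F` is *prime* if it is nonempty and its complement is a nonempty ideal. -/
def IsLatPrimeFilter {K : Type*} [Lattice K] (F : Set K) : Prop :=
  IsLatFilter F ∧ F.Nonempty ∧ Fᶜ.Nonempty ∧ IsLatIdeal Fᶜ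

open Topology

/-- The quotient of a lattice by a lattice congruence. -/
def LatticeCon.Quot {α : Type*} [Lattice α] (c : LatticeCon α) : Type _ :=
  Quotient c.toSetoid

instance LatticeCon.instDistribLatticeQuot {α : Type*} [DistribLattice α] (c : LatticeCon α) :
    DistribLattice c.Quot :=
  letI : Max c.Quot := ⟨Quotient.map₂ (· ⊔ ·) fun _ _ h _ _ h' => c.sup h h'⟩
  letI : Min c.Quot := ⟨Quotient.map₂ (· ⊓ ·) fun _ _ h _ _ h' => c.inf h h'⟩
  letI : Lattice c.Quot := Lattice.mk'
    (by rintro ⟨x⟩ ⟨y⟩; exact congrArg (Quotient.mk _) (sup_comm x y))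
    (by rintro ⟨x⟩ ⟨y⟩ ⟨z⟩; exact congrArg (Quotient.mk _) (sup_assoc x y z))
    (by rintro ⟨x⟩ ⟨y⟩; exact congrArg (Quotient.mk _) (inf_comm x y))
    (by rintro ⟨x⟩ ⟨y⟩ ⟨z⟩; exact congrArg (Quotient.mk _) (inf_assoc x y z))
    (by rintro ⟨x⟩ ⟨y⟩; exact congrArg (Quotient.mk _) (sup_inf_self (a := x) (b := y)))
    (by rintro ⟨x⟩ ⟨y⟩; exact congrArg (Quotient.mk _) (inf_sup_self (a := x) (b := y)))
  { le_sup_inf := by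
      rintro ⟨x⟩ ⟨y⟩ ⟨z⟩
      exact le_of_eq (α := c.Quot) (congrArg (Quotient.mk _) (sup_inf_left x y z).symm) }

/-- The projection of a distributive lattice onto its quotient by a lattice congruence. -/
def LatticeCon.mkHom {α : Type*} [DistribLattice α] (c : LatticeCon α) : LatticeHom α c.Quot where
  toFun := Quotient.mk _
  map_sup' _ _ := rfl
  map_inf' _ _ := rfl

/-- The syntactic congruence of a subset `C` of a distributive lattice: `x` and `y` are related
when no translation `t ↦ (t ⊓ p) ⊔ q` separates them with respect to `C`. -/
def LatticeCon.syntactic {α : Type*} [DistribLattice α] (C : Set α) : LatticeCon α where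
  r x y := ∀ p q, x ⊓ p ⊔ q ∈ C ↔ y ⊓ p ⊔ q ∈ C
  iseqv := ⟨fun _ _ _ => Iff.rfl, fun h p q => (h p q).symm,
    fun h h' p q => (h p q).trans (h' p q)⟩
  inf := by
    intro w x y z h h' p q
    have h₁ := h (y ⊓ p) q
    have h₂ := h' (x ⊓ p) q
    rw [← inf_assoc, ← inf_assoc] at h₁ h₂
    rw [h₁, inf_comm x y, h₂, inf_comm z x]
  sup := by
    intro w x y z h h' p q
    have h₁ := h p (y ⊓ p ⊔ q)
    have h₂ := h' p (x ⊓ p ⊔ q)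
    rw [← sup_assoc, ← sup_assoc, ← inf_sup_right, ← inf_sup_right] at h₁ h₂
    rw [h₁, sup_comm x y, h₂, sup_comm z x]

/-- The syntactic congruence of a clopen subset of a compact topological distributive lattice has
open classes. -/
theorem LatticeCon.isLocallyConstant_mkHom_syntactic {K : Type*} [TopologicalSpace K]
    [CompactSpace K] [DistribLattice K] [ContinuousInf K] [ContinuousSup K] {C : Set K} (hC : IsClopen C) :
    IsLocallyConstant (LatticeCon.syntactic C).mkHom := by
  rw [IsLocallyConstant.iff_eventually_eq]
  intro x
  have key : ∀ᶠ y in 𝓝 x, ∀ pq ∈ (Set.univ : Set (K × K)),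
      (y ⊓ pq.1 ⊔ pq.2 ∈ C ↔ x ⊓ pq.1 ⊔ pq.2 ∈ C) := by
    refine isCompact_univ.eventually_forall_of_forall_eventually fun pq _ => ?_
    have hD : IsClopen {z : K × (K × K) | z.1 ⊓ z.2.1 ⊔ z.2.2 ∈ C} :=
      hC.preimage (f := fun z : K × (K × K) => z.1 ⊓ z.2.1 ⊔ z.2.2) (by fun_prop)
    have hE : IsClopen {z : K × (K × K) | x ⊓ z.2.1 ⊔ z.2.2 ∈ C} :=
      hC.preimage (f := fun z : K × (K × K) => x ⊓ z.2.1 ⊔ z.2.2) (by fun_prop)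
    by_cases h : x ⊓ pq.1 ⊔ pq.2 ∈ C
    · filter_upwards [hD.isOpen.mem_nhds (x := (x, pq)) h, hE.isOpen.mem_nhds (x := (x, pq)) h]
        with z h₁ h₂ using iff_of_true h₁ h₂
    · filter_upwards [hD.compl.isOpen.mem_nhds (x := (x, pq)) h,
        hE.compl.isOpen.mem_nhds (x := (x, pq)) h] with z h₁ h₂ using iff_of_false h₁ h₂
  filter_upwards [key] with y hy
  exact Quotient.sound fun p q => hy (p, q) trivial

/-- In a distributive lattice, `a ≰ b` is witnessed by a prime ideal containing `b` but not `a`. -/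
theorem DistribLattice.exists_isPrime_of_not_le {α : Type*} [DistribLattice α] {a b : α}
    (hab : ¬ a ≤ b) : ∃ J : Order.Ideal α, J.IsPrime ∧ b ∈ J ∧ a ∉ J := by
  obtain ⟨J, hJ, hbJ, haJ⟩ := DistribLattice.prime_ideal_of_disjoint_filter_ideal
    (F := Order.PFilter.principal a) (I := Order.Ideal.principal b)
    (Set.disjoint_left.2 fun x hx hx' =>
      hab ((Order.PFilter.mem_principal.1 hx).trans (Order.Ideal.mem_principal.1 hx')))
  exact ⟨J, hJ, hbJ (Order.Ideal.mem_principal.2 le_rfl),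
    Set.disjoint_left.1 haJ (Order.PFilter.mem_principal.2 le_rfl)⟩

/-- The complement of the preimage of a prime ideal under a lattice homomorphism is a prime filter
as soon as it and its complement are nonempty. -/
theorem isLatPrimeFilter_preimage_compl {α β : Type*} [Lattice α] [Lattice β] (f : LatticeHom α β)
    {J : Order.Ideal β} (hJ : J.IsPrime) {a b : α} (ha : f a ∉ J) (hb : f b ∈ J) :
    IsLatPrimeFilter (f ⁻¹' (J : Set β)ᶜ) := by
  refine ⟨fun x hx y hy z hz hzJ => ?_, ⟨a, ha⟩, ⟨b, fun h => h hb⟩, fun x hx y hy z hz hzJ => ?_⟩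
  · have : f x ⊓ f y ∈ J :=
      J.lower (by rw [← map_inf]; exact OrderHomClass.mono f hz) hzJ
    exact (hJ.mem_or_mem this).elim hx hy
  · have : f x ⊔ f y ∈ J := Order.Ideal.sup_mem (not_not.1 hx) (not_not.1 hy)
    exact hzJ (J.lower (by rw [← map_sup]; exact OrderHomClass.mono f hz) this)

/-- In a compact Hausdorff totally disconnected topological distributive lattice with
`0` and `1` and jointly continuous operations, for every `a ≰ b` there is a clopen
prime filter containing `a` but not `b`. -/
theorem stmt5 {K : Type*} [TopologicalSpace K] [CompactSpace K] [T2Space K]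
    [TotallyDisconnectedSpace K] [DistribLattice K] [BoundedOrder K]
    (hmeet : Continuous fun x : K × K => x.1 ⊓ x.2)
    (hjoin : Continuous fun x : K × K => x.1 ⊔ x.2)
    (a b : K) (hab : ¬ a ≤ b) :
    ∃ P : Set K, IsClopen P ∧ IsLatPrimeFilter P ∧ a ∈ P ∧ b ∉ P := by
  have : ContinuousInf K := ⟨hmeet⟩
  have : ContinuousSup K := ⟨hjoin⟩
  obtain ⟨C, hC, haC, hCb⟩ := compact_exists_isClopen_in_isOpen
    (isOpen_compl_singleton (x := a ⊓ b)) (x := a) fun h => hab (inf_eq_left.1 h.symm)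
  let c := LatticeCon.syntactic C
  let f := c.mkHom
  have hf : ¬ f a ≤ f b := fun h => by
    have h' : f a = f (a ⊓ b) := by rw [map_inf, inf_eq_left.2 h]
    have h₁ := (Quotient.exact h' : ∀ p q, a ⊓ p ⊔ q ∈ C ↔ a ⊓ b ⊓ p ⊔ q ∈ C) ⊤ ⊥
    rw [inf_top_eq, inf_top_eq, sup_bot_eq, sup_bot_eq] at h₁
    exact hCb (h₁.1 haC) rfl
  obtain ⟨J, hJ, hbJ, haJ⟩ := DistribLattice.exists_isPrime_of_not_le hf
  have hloc : IsLocallyConstant f := LatticeCon.isLocallyConstant_mkHom_syntactic hC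
  exact ⟨f ⁻¹' (J : Set c.Quot)ᶜ, ⟨⟨hloc ((J : Set c.Quot)ᶜᶜ)⟩, hloc _⟩,
    isLatPrimeFilter_preimage_compl f hJ haJ hbJ, haJ, fun h => h hbJ⟩
end

section
/- Let K be a compact Hausdorff topological distributive lattice whose operations ⊓ and ⊔ are jointly continuous. If 𝔉 is a family of closed convex subsets of K with empty intersection ⋂𝔉 = ∅, then there exist A, B ∈ 𝔉 with A ∩ B = ∅. -/
/-- A subset is *convex* if it is the intersection of an ideal and a filter. -/
def IsLatConvex {K : Type*} [Lattice K] (G : Set K) : Prop :=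
  ∃ I F : Set K, IsLatIdeal I ∧ IsLatFilter F ∧ G = I ∩ F

theorem IsLatConvex.mem_of_inf_le_of_le_sup {K : Type*} [Lattice K] {G : Set K}
    (hG : IsLatConvex G) {a b x : K} (ha : a ∈ G) (hb : b ∈ G) (h₁ : a ⊓ b ≤ x)
    (h₂ : x ≤ a ⊔ b) : x ∈ G := by
  obtain ⟨I, F, hI, hF, rfl⟩ := hG
  exact ⟨hI a ha.1 b hb.1 x h₂, hF a ha.2 b hb.2 x h₁⟩

theorem IsLatConvex.inter {K : Type*} [Lattice K] {A B : Set K}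
    (hA : IsLatConvex A) (hB : IsLatConvex B) : IsLatConvex (A ∩ B) := by
  obtain ⟨I, F, hI, hF, rfl⟩ := hA
  obtain ⟨J, G, hJ, hG, rfl⟩ := hB
  refine ⟨I ∩ J, F ∩ G, ?_, ?_, Set.inter_inter_inter_comm I F J G⟩
  · exact fun a ha b hb x hx => ⟨hI a ha.1 b hb.1 x hx, hJ a ha.2 b hb.2 x hx⟩
  · exact fun a ha b hb x hx => ⟨hF a ha.1 b hb.1 x hx, hG a ha.2 b hb.2 x hx⟩

/-- Three pairwise intersecting convex sets have a common point, namely the median of points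
chosen in the pairwise intersections. -/
theorem IsLatConvex.inter_inter_nonempty {K : Type*} [DistribLattice K] {A B C : Set K}
    (hA : IsLatConvex A) (hB : IsLatConvex B) (hC : IsLatConvex C)
    (hAB : (A ∩ B).Nonempty) (hAC : (A ∩ C).Nonempty) (hBC : (B ∩ C).Nonempty) :
    (A ∩ B ∩ C).Nonempty := by
  obtain ⟨c, hcA, hcB⟩ := hAB
  obtain ⟨b, hbA, hbC⟩ := hAC
  obtain ⟨a, haB, haC⟩ := hBC
  refine ⟨(a ⊓ b) ⊔ (b ⊓ c) ⊔ (a ⊓ c), ⟨?_, ?_⟩, ?_⟩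
  · exact hA.mem_of_inf_le_of_le_sup hbA hcA (le_sup_right.trans le_sup_left)
      (sup_le (sup_le (inf_le_right.trans le_sup_left) (inf_le_left.trans le_sup_left))
        (inf_le_right.trans le_sup_right))
  · exact hB.mem_of_inf_le_of_le_sup haB hcB le_sup_right
      (sup_le (sup_le (inf_le_left.trans le_sup_left) (inf_le_right.trans le_sup_right))
        (inf_le_left.trans le_sup_left))
  · exact hC.mem_of_inf_le_of_le_sup haC hbC (le_sup_left.trans le_sup_left)
      (sup_le (sup_le (inf_le_left.trans le_sup_left) (inf_le_left.trans le_sup_right))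
        (inf_le_left.trans le_sup_left))

/-- The Helly property: finitely many pairwise intersecting convex sets have a common point. -/
theorem IsLatConvex.biInter_finset_nonempty {K ι : Type*} [DistribLattice K] [Nonempty K]
    (s : Finset ι) (A : ι → Set K) (hA : ∀ i ∈ s, IsLatConvex (A i))
    (hAA : ∀ i ∈ s, ∀ j ∈ s, (A i ∩ A j).Nonempty) : (⋂ i ∈ s, A i).Nonempty := by
  classical
  induction s using Finset.induction_on generalizing A with
  | empty => simp
  | insert k s _ ih =>
    have hk := Finset.mem_insert_self k s
    have hs : ∀ i ∈ s, i ∈ insert k s := fun i hi => Finset.mem_insert_of_mem hi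
    rcases s.eq_empty_or_nonempty with rfl | ⟨i₀, hi₀⟩
    · simpa using hAA k hk k hk
    · obtain ⟨x, hx⟩ := ih (fun i => A i ∩ A k)
        (fun i hi => (hA i (hs i hi)).inter (hA k hk)) fun i hi j hj => by
          rw [← Set.inter_inter_distrib_right]
          exact (hA i (hs i hi)).inter_inter_nonempty (hA j (hs j hj)) (hA k hk)
            (hAA i (hs i hi) j (hs j hj)) (hAA i (hs i hi) k hk) (hAA j (hs j hj) k hk)
      rw [Set.mem_iInter₂] at hx
      refine ⟨x, Set.mem_iInter₂.2 fun i hi => ?_⟩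
      rcases Finset.mem_insert.1 hi with rfl | hi
      · exact (hx i₀ hi₀).2
      · exact (hx i hi).1

/-- In a compact Hausdorff topological distributive lattice with jointly continuous
operations, every family of closed convex sets with empty intersection contains two
disjoint members. -/
theorem stmt6 {K : Type*} [TopologicalSpace K] [CompactSpace K] [T2Space K]
    [Nonempty K] [DistribLattice K]
    (hmeet : Continuous fun x : K × K => x.1 ⊓ x.2)
    (hjoin : Continuous fun x : K × K => x.1 ⊔ x.2)
    (𝔉 : Set (Set K)) (hconv : ∀ A ∈ 𝔉, IsClosed A ∧ IsLatConvex A)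
    (hempty : ⋂₀ 𝔉 = ∅) :
    ∃ A ∈ 𝔉, ∃ B ∈ 𝔉, A ∩ B = ∅ := by
  by_contra! h
  refine Set.Nonempty.ne_empty ?_ hempty
  have hne := isCompact_univ.inter_iInter_nonempty (fun A : 𝔉 => (A : Set K))
    (fun A => (hconv A A.2).1) fun u => by
      rw [Set.univ_inter]
      exact IsLatConvex.biInter_finset_nonempty u _ (fun A _ => (hconv A A.2).2)
        fun A _ B _ => h A A.2 B B.2
  rwa [Set.univ_inter, ← Set.sInter_eq_iInter] at hne
end

section
/- Let K be a modest semilattice. Then the set C(K, {0,1}) of continuous functions from K to the two-point discrete space {0,1} is σ-discrete in the topology of pointwise convergence: C(K, {0,1}) can be written as a countable union ⋃_{m∈ℕ} D_m such that for every m and every f ∈ D_m there exists a finite set M ⊆ K such that the only g ∈ D_m satisfying g(x) = f(x) for all x ∈ M is g = f. -/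
open Set Topology

section Closedness

variable {K : Type*} [TopologicalSpace K] [T2Space K] [SemilatticeInf K]

/-- In a Hausdorff topological semilattice, principal filters are closed. -/
theorem isClosed_Ici_of_continuous_inf (hmeet : Continuous fun x : K × K => x.1 ⊓ x.2) (a : K) :
    IsClosed (Ici a) := by
  have h : Ici a = {x : K | a ⊓ x = a} := by ext x; simp
  rw [h]
  exact isClosed_eq (hmeet.comp (continuous_const.prodMk continuous_id)) continuous_const

/-- In a Hausdorff topological semilattice, principal ideals are closed. -/
theorem isClosed_Iic_of_continuous_inf (hmeet : Continuous fun x : K × K => x.1 ⊓ x.2) (a : K) :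
    IsClosed (Iic a) := by
  have h : Iic a = {x : K | x ⊓ a = x} := by ext x; simp
  rw [h]
  exact isClosed_eq (hmeet.comp (continuous_id.prodMk continuous_const)) continuous_id

variable [CompactSpace K]

/-- If the principal filter of `p` is open, then `p` is a compact element. -/
theorem compactElem_of_isOpen_Ici (hmeet : Continuous fun x : K × K => x.1 ⊓ x.2) {p : K}
    (hp : IsOpen (Ici p)) : CompactElem p := by
  classical
  intro A hA
  have hdis : (Ici p)ᶜ ∩ ⋂ a : A, Ici (a : K) = ∅ := by
    refine eq_empty_of_forall_notMem fun z hz => hz.1 (hA.2 fun a ha => ?_)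
    exact mem_iInter.1 hz.2 ⟨a, ha⟩
  obtain ⟨t, ht⟩ := hp.isClosed_compl.isCompact.elim_finite_subfamily_closed _
    (fun a : A => isClosed_Ici_of_continuous_inf hmeet (a : K)) hdis
  refine ⟨t.image Subtype.val, by simp, ?_, ?_⟩
  · intro a ha
    obtain ⟨b, -, rfl⟩ := Finset.mem_image.1 (Finset.mem_coe.1 ha)
    exact hA.1 b.2
  · intro u hu
    by_contra hpu
    have hmem : u ∈ (Ici p)ᶜ ∩ ⋂ a ∈ t, Ici (a : K) :=
      ⟨hpu, mem_iInter₂.2 fun a ha => hu (Finset.mem_coe.2 (Finset.mem_image_of_mem _ ha))⟩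
    rw [ht] at hmem
    exact hmem

/-- If the principal filter of `p` is open, then every element strictly below `p` lies below an
immediate predecessor of `p`. -/
theorem exists_le_covBy_of_isOpen_Ici (hmeet : Continuous fun x : K × K => x.1 ⊓ x.2) {p : K}
    (hp : IsOpen (Ici p)) {x : K} (hx : x < p) : ∃ y, x ≤ y ∧ y ⋖ p := by
  obtain ⟨m, hxm, hm⟩ := zorn_le_nonempty₀ (Iio p) (by
    intro c hcs hc y hy
    have : Nonempty c := ⟨⟨y, hy⟩⟩
    obtain ⟨z, hz⟩ := IsCompact.nonempty_iInter_of_directed_nonempty_isCompact_isClosed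
      (fun a : c => Ici (a : K) ∩ (Iic p ∩ (Ici p)ᶜ))
      (by
        intro a b
        rcases hc.total a.2 b.2 with h | h
        · exact ⟨b, inter_subset_inter_left _ (Ici_subset_Ici.2 h), subset_rfl⟩
        · exact ⟨a, subset_rfl, inter_subset_inter_left _ (Ici_subset_Ici.2 h)⟩)
      (fun a => ⟨a, le_rfl, (hcs a.2).le, (hcs a.2).not_ge⟩)
      (fun a => ((isClosed_Ici_of_continuous_inf hmeet _).inter
        ((isClosed_Iic_of_continuous_inf hmeet p).inter hp.isClosed_compl)).isCompact)
      (fun a => (isClosed_Ici_of_continuous_inf hmeet _).inter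
        ((isClosed_Iic_of_continuous_inf hmeet p).inter hp.isClosed_compl))
    rw [mem_iInter] at hz
    exact ⟨z, lt_of_le_not_ge (hz ⟨y, hy⟩).2.1 (hz ⟨y, hy⟩).2.2, fun a ha => (hz ⟨a, ha⟩).1⟩)
    x hx
  exact ⟨m, hxm, hm.prop, fun z hmz hzp => hmz.not_ge (hm.le_of_ge hzp hmz.le)⟩

/-- A nonempty closed subsemilattice of a compact semilattice has a least element. -/
theorem exists_isLeast_of_isClosed (hmeet : Continuous fun x : K × K => x.1 ⊓ x.2) {E : Set K}
    (hE : IsClosed E) (hne : E.Nonempty) (hinf : ∀ x ∈ E, ∀ y ∈ E, x ⊓ y ∈ E) :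
    ∃ p, IsLeast E p := by
  obtain ⟨e, he⟩ := hne
  have : Nonempty E := ⟨⟨e, he⟩⟩
  obtain ⟨z, hz⟩ := IsCompact.nonempty_iInter_of_directed_nonempty_isCompact_isClosed
    (fun a : E => Iic (a : K) ∩ E)
    (fun a b => ⟨⟨a ⊓ b, hinf _ a.2 _ b.2⟩,
      inter_subset_inter_left _ (Iic_subset_Iic.2 inf_le_left),
      inter_subset_inter_left _ (Iic_subset_Iic.2 inf_le_right)⟩)
    (fun a => ⟨a, le_rfl, a.2⟩)
    (fun a => ((isClosed_Iic_of_continuous_inf hmeet _).inter hE).isCompact)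
    (fun a => (isClosed_Iic_of_continuous_inf hmeet _).inter hE)
  rw [mem_iInter] at hz
  exact ⟨z, (hz ⟨e, he⟩).2, fun a ha => (hz ⟨a, ha⟩).1⟩

end Closedness

/-- The class of `a` under the syntactic congruence of a subset `W` of a semilattice. -/
def syntacticClass {K : Type*} [SemilatticeInf K] (W : Set K) (a : K) : Set K :=
  {x | ∀ y, x ⊓ y ∈ W ↔ a ⊓ y ∈ W}

section SyntacticClass

variable {K : Type*} [SemilatticeInf K] {W : Set K} {a b x y : K}

theorem mem_syntacticClass_self (W : Set K) (a : K) : a ∈ syntacticClass W a := fun _ => Iff.rfl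

theorem syntacticClass_eq_of_mem (h : x ∈ syntacticClass W a) :
    syntacticClass W x = syntacticClass W a := by
  ext z
  exact forall_congr' fun y => iff_congr Iff.rfl (h y)

theorem inf_mem_syntacticClass (hx : x ∈ syntacticClass W a) (hy : y ∈ syntacticClass W b) :
    x ⊓ y ∈ syntacticClass W (a ⊓ b) := by
  intro z
  rw [inf_assoc, hx, inf_left_comm, hy, inf_left_comm, inf_assoc]

theorem mem_iff_of_mem_syntacticClass (h : x ∈ syntacticClass W a) : x ∈ W ↔ a ∈ W := by
  have h₁ := h x
  have h₂ := h a
  rw [inf_idem] at h₁ h₂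
  rw [h₁, ← h₂, inf_comm]

variable [TopologicalSpace K]

theorem isClopen_setOf_inf_mem_iff (hmeet : Continuous fun x : K × K => x.1 ⊓ x.2)
    (hW : IsClopen W) (a : K) :
    IsClopen {q : K × K | q.1 ⊓ q.2 ∈ W ↔ a ⊓ q.2 ∈ W} := by
  have h₁ : IsClopen {q : K × K | q.1 ⊓ q.2 ∈ W} := hW.preimage hmeet
  have h₂ : IsClopen {q : K × K | a ⊓ q.2 ∈ W} :=
    hW.preimage (hmeet.comp (continuous_const.prodMk continuous_snd))
  have h : {q : K × K | q.1 ⊓ q.2 ∈ W ↔ a ⊓ q.2 ∈ W} =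
      ({q : K × K | q.1 ⊓ q.2 ∈ W} ∩ {q : K × K | a ⊓ q.2 ∈ W}) ∪
      ({q : K × K | q.1 ⊓ q.2 ∈ W}ᶜ ∩ {q : K × K | a ⊓ q.2 ∈ W}ᶜ) := by
    ext q
    simp only [mem_ofPred_eq, mem_union, mem_inter_iff, mem_compl_iff]
    tauto
  rw [h]
  exact (h₁.inter h₂).union (h₁.compl.inter h₂.compl)

theorem isClosed_syntacticClass (hmeet : Continuous fun x : K × K => x.1 ⊓ x.2)
    (hW : IsClopen W) (a : K) : IsClosed (syntacticClass W a) := by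
  have h : syntacticClass W a =
      ⋂ y, (fun x : K => (x, y)) ⁻¹' {q : K × K | q.1 ⊓ q.2 ∈ W ↔ a ⊓ q.2 ∈ W} := by
    ext x; simp [syntacticClass]
  rw [h]
  exact isClosed_iInter fun y => (isClopen_setOf_inf_mem_iff hmeet hW a).isClosed.preimage
    (Continuous.prodMk_left y)

theorem isOpen_syntacticClass [CompactSpace K] (hmeet : Continuous fun x : K × K => x.1 ⊓ x.2)
    (hW : IsClopen W) (a : K) : IsOpen (syntacticClass W a) := by
  have h : syntacticClass W a =
      (Prod.fst '' {q : K × K | q.1 ⊓ q.2 ∈ W ↔ a ⊓ q.2 ∈ W}ᶜ)ᶜ := by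
    ext x; simp [syntacticClass]
  rw [h, isOpen_compl_iff]
  exact isClosedMap_fst_of_compactSpace _
    (isClopen_setOf_inf_mem_iff hmeet hW a).compl.isClosed

/-- Sending each point to the least element of its syntactic class modulo a clopen set `W` is a
locally constant retraction onto a set of elements with open principal filters. -/
theorem exists_isLocallyConstant_retraction [CompactSpace K] [T2Space K]
    (hmeet : Continuous fun x : K × K => x.1 ⊓ x.2) (hW : IsClopen W) :
    ∃ π : K → K, IsLocallyConstant π ∧ (∀ x, π x ≤ x) ∧ (∀ x, π x ∈ W ↔ x ∈ W) ∧
      (∀ x z, π z ≤ x → π z ≤ π x) ∧ ∀ x, IsOpen (Ici (π x)) := by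
  have hleast : ∀ a, ∃ p, IsLeast (syntacticClass W a) p := fun a =>
    exists_isLeast_of_isClosed hmeet (isClosed_syntacticClass hmeet hW a)
      ⟨a, mem_syntacticClass_self W a⟩ fun x hx y hy => by
        simpa using inf_mem_syntacticClass hx hy
  choose π hπ using hleast
  refine ⟨π, ?_, fun x => (hπ x).2 (mem_syntacticClass_self W x),
    fun x => mem_iff_of_mem_syntacticClass (hπ x).1, ?_, ?_⟩
  · rw [IsLocallyConstant.iff_exists_open]
    refine fun x => ⟨_, isOpen_syntacticClass hmeet hW x, mem_syntacticClass_self W x, ?_⟩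
    intro y hy
    have h := hπ y
    rw [syntacticClass_eq_of_mem hy] at h
    exact h.unique (hπ x)
  · intro x z hzx
    have h := inf_mem_syntacticClass (mem_syntacticClass_self W (π z)) (hπ x).1
    rw [inf_eq_left.2 hzx, syntacticClass_eq_of_mem (hπ z).1] at h
    exact ((hπ z).2 h).trans inf_le_right
  · intro z
    have h : Ici (π z) = (fun x => x ⊓ π z) ⁻¹' syntacticClass W z := by
      ext x
      refine ⟨fun hx => ?_, fun hx => ((hπ z).2 hx).trans inf_le_left⟩
      rw [mem_preimage, inf_eq_right.2 hx]
      exact (hπ z).1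
    rw [h]
    exact (isOpen_syntacticClass hmeet hW z).preimage
      (hmeet.comp (continuous_id.prodMk continuous_const))

end SyntacticClass

open Classical in
/-- Every function on a finite set in a partial order is a combination of indicators of
principal filters. -/
theorem exists_sum_ite_le_eq {K R : Type*} [PartialOrder K] [AddCommGroup R] (f : K → R)
    (P : Finset K) : ∃ c : K → R, ∀ p ∈ P, ∑ q ∈ P, (if q ≤ p then c q else 0) = f p := by
  induction P using Finset.strongInduction with
  | H P ih =>
    rcases P.eq_empty_or_nonempty with rfl | hne
    · exact ⟨0, by simp⟩
    obtain ⟨m, hm⟩ := P.exists_maximal hne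
    obtain ⟨c, hc⟩ := ih _ (Finset.erase_ssubset hm.prop)
    refine ⟨Function.update c m (f m - ∑ q ∈ P.erase m, if q ≤ m then c q else 0), ?_⟩
    intro p hp
    rw [← Finset.add_sum_erase _ _ hm.prop, Function.update_self]
    have hsum : ∑ q ∈ P.erase m, (if q ≤ p then
        Function.update c m (f m - ∑ q ∈ P.erase m, if q ≤ m then c q else 0) q else 0) =
        ∑ q ∈ P.erase m, if q ≤ p then c q else 0 :=
      Finset.sum_congr rfl fun q hq => by
        rw [Function.update_of_ne (Finset.ne_of_mem_erase hq)]
    rw [hsum]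
    by_cases hpm : p = m
    · subst hpm
      simp
    · rw [hc p (Finset.mem_erase.2 ⟨hpm, hp⟩), if_neg, zero_add]
      exact fun hmp => hpm (le_antisymm (hm.le_of_ge hp hmp) hmp)

open Classical in
/-- Every continuous Boolean function on a compact semilattice is a sum modulo two of finitely
many indicators of open principal filters. -/
theorem exists_eq_sum_indicator_Ici {K : Type*} [TopologicalSpace K] [CompactSpace K] [T2Space K]
    [SemilatticeInf K] (hmeet : Continuous fun x : K × K => x.1 ⊓ x.2) {f : K → Bool}
    (hf : Continuous f) :
    ∃ G : Finset K, (∀ p ∈ G, IsOpen (Ici p)) ∧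
      ∀ x, (if f x then 1 else 0 : ZMod 2) = ∑ p ∈ G, if p ≤ x then 1 else 0 := by
  obtain ⟨π, hloc, hle, hmem, hmax, hopen⟩ := exists_isLocallyConstant_retraction hmeet
    (W := f ⁻¹' {true}) ((isClopen_discrete _).preimage hf)
  have hfin : (range π).Finite := hloc.range_finite
  obtain ⟨c, hc⟩ := exists_sum_ite_le_eq (fun x => (if f x then 1 else 0 : ZMod 2)) hfin.toFinset
  refine ⟨hfin.toFinset.filter fun p => c p = 1, ?_, fun x => ?_⟩
  · intro p hp
    obtain ⟨z, rfl⟩ := hfin.mem_toFinset.1 (Finset.mem_filter.1 hp).1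
    exact hopen z
  · have hfx : f (π x) = f x := Bool.eq_iff_iff.2 (hmem x)
    rw [← hfx, ← hc (π x) (hfin.mem_toFinset.2 (mem_range_self x)), Finset.sum_filter]
    refine Finset.sum_congr rfl fun q hq => ?_
    obtain ⟨z, rfl⟩ := hfin.mem_toFinset.1 hq
    have hiff : π z ≤ π x ↔ π z ≤ x := ⟨fun h => h.trans (hle x), hmax x z⟩
    have hz : c (π z) = 0 ∨ c (π z) = 1 := by
      generalize c (π z) = t
      revert t
      decide
    rcases hz with h | h <;> simp [hiff, h]

open Classical in
/-- Inclusion-exclusion over a finite set `P` of elements below `p`, when every element strictly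
below `p` lies below a member of `P`: the alternating sum of the indicator of the principal filter
of `x` over the meets of subsets of `P` detects whether `x = p`. -/
theorem sum_powerset_ite_le_inf' {K : Type*} [SemilatticeInf K] {p : K} {P : Finset K}
    (hlt : ∀ y ∈ P, y < p) (hP : ∀ x < p, ∃ y ∈ P, x ≤ y) (x : K) :
    ∑ S ∈ P.powerset,
      (if x ≤ (insert p S).inf' (Finset.insert_nonempty p S) id then 1 else 0 : ZMod 2) =
      if x = p then 1 else 0 := by
  have hterm : ∀ S ∈ P.powerset,
      (if x ≤ (insert p S).inf' (Finset.insert_nonempty p S) id then 1 else 0 : ZMod 2) =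
      (if x ≤ p then 1 else 0) * ∏ y ∈ S, if x ≤ y then 1 else 0 := by
    intro S _
    rw [Finset.prod_ite_zero]
    by_cases h : x ≤ p <;> simp [h, Finset.le_inf'_iff]
  rw [Finset.sum_congr rfl hterm, ← Finset.mul_sum, ← Finset.prod_one_add]
  by_cases hxp : x = p
  · subst hxp
    rw [Finset.prod_eq_one fun y hy => by rw [if_neg (hlt y hy).not_ge, add_zero]]
    simp
  · rw [if_neg hxp]
    by_cases hle : x ≤ p
    · obtain ⟨y, hy, hxy⟩ := hP x (lt_of_le_of_ne hle hxp)
      rw [Finset.prod_eq_zero hy (by rw [if_pos hxy]; decide), mul_zero]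
    · rw [if_neg hle, zero_mul]

/-- If `K` is a modest semilattice (a compact Hausdorff totally disconnected
topological meet-semilattice with least element and jointly continuous meet, in
which every compact element has finitely many immediate predecessors), then
`C(K, {0,1})` is `σ`-discrete in the topology of pointwise convergence: it is a
countable union of sets `D m` such that each `f ∈ D m` is determined within `D m`
by its values on some finite set. -/
theorem stmt9 {K : Type*} [TopologicalSpace K] [CompactSpace K] [T2Space K]
    [TotallyDisconnectedSpace K] [SemilatticeInf K] [OrderBot K]
    (hmeet : Continuous fun x : K × K => x.1 ⊓ x.2)
    (hmodest : ∀ p : K, CompactElem p → {x : K | x ⋖ p}.Finite) :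
    ∃ D : ℕ → Set (K → Bool),
      (⋃ m, D m) = {f : K → Bool | Continuous f} ∧
      ∀ m : ℕ, ∀ f ∈ D m, ∃ M : Finset K,
        ∀ g ∈ D m, (∀ x ∈ M, g x = f x) → g = f := by
  classical
  have hpred : ∀ p : K, ∃ P : Finset K, IsOpen (Ici p) →
      (∀ y ∈ P, y < p) ∧ ∀ x < p, ∃ y ∈ P, x ≤ y := by
    intro p
    by_cases hp : IsOpen (Ici p)
    · have hfin := hmodest p (compactElem_of_isOpen_Ici hmeet hp)
      refine ⟨hfin.toFinset, fun _ => ⟨fun y hy => (hfin.mem_toFinset.1 hy).lt, fun x hx => ?_⟩⟩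
      obtain ⟨y, hxy, hy⟩ := exists_le_covBy_of_isOpen_Ici hmeet hp hx
      exact ⟨y, hfin.mem_toFinset.2 hy, hxy⟩
    · exact ⟨∅, fun h => absurd h hp⟩
  choose P hP using hpred
  have hcoeff : ∀ (G : Finset K) (f : K → Bool),
      (∀ x, (if f x then 1 else 0 : ZMod 2) = ∑ q ∈ G, if q ≤ x then 1 else 0) →
      ∀ p, IsOpen (Ici p) → ∑ S ∈ (P p).powerset,
        (if f ((insert p S).inf' (Finset.insert_nonempty p S) id) then 1 else 0 : ZMod 2) =
        if p ∈ G then 1 else 0 := by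
    intro G f hf p hp
    rw [Finset.sum_congr rfl fun S _ => hf _, Finset.sum_comm,
      Finset.sum_congr rfl fun x _ => sum_powerset_ite_le_inf' (hP p hp).1 (hP p hp).2 x,
      Finset.sum_ite_eq']
  refine ⟨fun m => {f | Continuous f ∧ ∃ G : Finset K, G.card = m ∧ (∀ p ∈ G, IsOpen (Ici p)) ∧
      ∀ x, (if f x then 1 else 0 : ZMod 2) = ∑ p ∈ G, if p ≤ x then 1 else 0}, ?_, ?_⟩
  · ext f
    simp only [mem_iUnion, mem_ofPred_eq]
    constructor
    · rintro ⟨_, hf, -⟩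
      exact hf
    · intro hf
      obtain ⟨G, hG, hfG⟩ := exists_eq_sum_indicator_Ici hmeet hf
      exact ⟨G.card, hf, G, rfl, hG, hfG⟩
  · rintro m f ⟨-, F, hFm, hF, hfF⟩
    refine ⟨F.biUnion fun p => (P p).powerset.image fun S =>
      (insert p S).inf' (Finset.insert_nonempty p S) id, ?_⟩
    rintro g ⟨-, G, hGm, -, hgG⟩ hfg
    have hsub : F ⊆ G := by
      intro p hp
      have h₁ := hcoeff F f hfF p (hF p hp)
      have h₂ := hcoeff G g hgG p (hF p hp)
      rw [Finset.sum_congr rfl fun S hS => by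
        rw [hfg _ (Finset.mem_biUnion.2 ⟨p, hp, Finset.mem_image_of_mem _ hS⟩)], h₁,
        if_pos hp] at h₂
      by_contra hpG
      simp [hpG] at h₂
    have hFG : F = G := Finset.eq_of_subset_of_card_le hsub (hGm.trans hFm.symm).le
    subst hFG
    funext x
    have h := (hgG x).trans (hfF x).symm
    revert h
    cases g x <;> cases f x <;> simp
end

section
/- Let K be a compact Hausdorff totally disconnected topological meet-semilattice with least element 0 and jointly continuous meet. If f : K → {0,1} is continuous (with {0,1} discrete) and not constant, then f has a jump at some positive compact element: there exists a compact element p ∈ K with p ≠ 0 such that f(p) ≠ f(x) for every immediate predecessor x of p. -/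
/-- A nonempty closed subset of a compact space with a partial order whose principal lower sets
are closed has a minimal element. -/
theorem exists_minimal_of_isClosed {K : Type*} [TopologicalSpace K] [CompactSpace K]
    [PartialOrder K] (hIic : ∀ a : K, IsClosed (Set.Iic a)) {U : Set K} (hU : IsClosed U)
    (hne : U.Nonempty) : ∃ p, Minimal (· ∈ U) p := by
  refine zorn_le₀ (α := Kᵒᵈ) U fun c hcU hc => ?_
  rcases c.eq_empty_or_nonempty with rfl | hcne
  · obtain ⟨x, hx⟩ := hne
    exact ⟨x, hx, fun _ h => h.elim⟩
  have : Nonempty c := hcne.to_subtype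
  obtain ⟨x, hx⟩ := IsCompact.nonempty_iInter_of_directed_nonempty_isCompact_isClosed
    (fun a : c => (U ∩ Set.Iic (OrderDual.ofDual a.1) : Set K))
    (fun a b => by
      rcases hc.total a.2 b.2 with h | h
      · exact ⟨b, fun y hy => ⟨hy.1, le_trans hy.2 (OrderDual.ofDual_le_ofDual.2 h)⟩,
          subset_rfl⟩
      · exact ⟨a, subset_rfl,
          fun y hy => ⟨hy.1, le_trans hy.2 (OrderDual.ofDual_le_ofDual.2 h)⟩⟩)
    (fun a => ⟨OrderDual.ofDual a.1, hcU a.2, le_rfl⟩)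
    (fun a => (hU.inter (hIic _)).isCompact) (fun a => hU.inter (hIic _))
  rw [Set.mem_iInter] at hx
  exact ⟨OrderDual.toDual x, (hx (Classical.arbitrary c)).1, fun a ha => (hx ⟨a, ha⟩).2⟩

/-- In a compact space with a meet-semilattice structure whose principal lower and upper sets
are closed, a minimal element of an open set is a compact element. -/
theorem compactElem_of_minimal_isOpen {K : Type*} [TopologicalSpace K] [CompactSpace K]
    [SemilatticeInf K] (hIic : ∀ a : K, IsClosed (Set.Iic a))
    (hIci : ∀ a : K, IsClosed (Set.Ici a)) {U : Set K} (hU : IsOpen U) {p : K}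
    (hp : Minimal (· ∈ U) p) : CompactElem p := by
  classical
  intro A hA
  by_contra! hfin
  obtain ⟨x, ⟨hxp, hxU⟩, hx⟩ := IsCompact.inter_iInter_nonempty
    (((hIic p).inter hU.isClosed_compl).isCompact) (fun a : A => Set.Ici (a : K))
    (fun a => hIci a) (fun F => by
      have hFA : ((F.image Subtype.val : Finset K) : Set K) ⊆ A := by
        intro y hy
        simp only [Finset.coe_image, Set.mem_image] at hy
        obtain ⟨a, -, rfl⟩ := hy
        exact a.2
      have hlub := hfin _ hFA
      have hub : p ∈ upperBounds ((F.image Subtype.val : Finset K) : Set K) :=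
        fun y hy => hA.1 (hFA hy)
      obtain ⟨u, hu, hpu⟩ : ∃ u ∈ upperBounds ((F.image Subtype.val : Finset K) : Set K),
          ¬ p ≤ u := by
        by_contra! h
        exact hlub ⟨hub, h⟩
      refine ⟨p ⊓ u, ⟨inf_le_left, fun h => hpu ?_⟩, Set.mem_iInter₂.2 fun a ha => ?_⟩
      · exact (hp.2 h inf_le_left).trans inf_le_right
      · exact le_inf (hA.1 a.2) (hu (Finset.mem_coe.2 (Finset.mem_image_of_mem _ ha))))
  rw [Set.mem_iInter] at hx
  have hpx : p ≤ x := hA.2 fun a ha => hx ⟨a, ha⟩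
  exact hxU (le_antisymm hpx hxp ▸ hp.1)

/-- In a compact Hausdorff totally disconnected topological meet-semilattice with
least element `0` and jointly continuous meet, every nonconstant continuous
`f : K → {0,1}` has a jump at some positive compact element `p`; that is,
`f p ≠ f x` for every immediate predecessor `x` of `p`. -/
theorem stmt10 {K : Type*} [TopologicalSpace K] [CompactSpace K] [T2Space K]
    [TotallyDisconnectedSpace K] [SemilatticeInf K] [OrderBot K]
    (hmeet : Continuous fun x : K × K => x.1 ⊓ x.2)
    (f : K → Bool) (hf : Continuous f) (hnc : ¬ ∀ x y : K, f x = f y) :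
    ∃ p : K, CompactElem p ∧ p ≠ ⊥ ∧ ∀ x : K, x ⋖ p → f p ≠ f x := by
  have hinf (a : K) : Continuous fun x : K => x ⊓ a :=
    hmeet.comp (continuous_id.prodMk continuous_const)
  have hIic (a : K) : IsClosed (Set.Iic a) := by
    have h : Set.Iic a = {x | x ⊓ a = x} := by ext; simp
    exact h ▸ isClosed_eq (hinf a) continuous_id
  have hIci (a : K) : IsClosed (Set.Ici a) := by
    have h : Set.Ici a = {x | x ⊓ a = a} := by ext; simp
    exact h ▸ isClosed_eq (hinf a) continuous_const
  have hU : IsClopen (f ⁻¹' {f ⊥}ᶜ) := (isClopen_discrete _).preimage hf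
  have hne : (f ⁻¹' {f ⊥}ᶜ).Nonempty := by
    by_contra! h
    have hbot (x : K) : f x = f ⊥ := by
      by_contra hx
      exact (h ▸ hx : x ∈ (∅ : Set K))
    exact hnc fun x y => (hbot x).trans (hbot y).symm
  obtain ⟨p, hp⟩ := exists_minimal_of_isClosed hIic hU.1 hne
  have hpf : f p ≠ f ⊥ := hp.1
  refine ⟨p, compactElem_of_minimal_isOpen hIic hIci hU.2 hp, fun h => hpf (h ▸ rfl), ?_⟩
  intro x hx hpx
  have hxU : f x ≠ f ⊥ := hpx ▸ hpf
  exact hx.lt.not_ge (hp.2 hxU hx.le)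
end

section
/- Let L₁, …, Lₙ be nonempty compact totally disconnected linearly ordered topological spaces with their order topologies and let K be a closed sublattice of ∏_{i=1}^n L_i with the product order and product topology. Then the Banach space C(K) of continuous real-valued functions on K with the supremum norm, endowed with the topology of pointwise convergence, has a countable cover by sets of small local norm-diameter: for every ε > 0 there exist sets X_m ⊆ C(K) (m ∈ ℕ) with C(K) = ⋃_{m∈ℕ} X_m such that for every m and every f ∈ X_m there exist a finite set F ⊆ K and δ > 0 with the property that any g, h ∈ X_m satisfying |g(x) − f(x)| < δ and |h(x) − f(x)| < δ for all x ∈ F obey sup_{x∈K} |g(x) − h(x)| < ε. -/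
/-- A list of intervals `[a, b]`, each labelled by a row, that pairwise do not overlap. -/
structure IsIntervalSystem {A B : Type*} [LinearOrder A] (l : List (A × A × B)) : Prop where
  le : ∀ e ∈ l, e.1 ≤ e.2.1
  disjoint : l.Pairwise fun e e' => e.2.1 ≤ e'.1 ∨ e'.2.1 ≤ e.1

/-- The variation of `ψ` along a list of labelled intervals, where each interval costs `η`. -/
def penalizedVariation {A B : Type*} (η : ℝ) (ψ : A → B → ℝ) (l : List (A × A × B)) : ℝ :=
  (l.map fun e => |ψ e.1 e.2.2 - ψ e.2.1 e.2.2| - η).sum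

/-- The supremum of the penalized variations of `ψ`. -/
noncomputable def maxVariation {A B : Type*} [LinearOrder A] (η : ℝ) (ψ : A → B → ℝ) : ℝ :=
  sSup {s | ∃ l : List (A × A × B), IsIntervalSystem l ∧ s = penalizedVariation η ψ l}

/-- `ψ` is bounded, and finitely many intervals cover `A` on which `ψ` varies by less than `η`,
uniformly in the second variable. -/
structure IsTame {A B : Type*} [LinearOrder A] (η : ℝ) (ψ : A → B → ℝ) : Prop where
  bounded : ∃ M, ∀ x y, |ψ x y| ≤ M
  cells : ∃ F : Finset A, ∀ w, ∃ u ∈ F, ∃ v ∈ F, u ≤ w ∧ w ≤ v ∧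
    ∀ x ∈ Set.Icc u v, ∀ x' ∈ Set.Icc u v, ∀ y, |ψ x y - ψ x' y| < η

theorem penalizedVariation_cons {A B : Type*} {η : ℝ} {ψ : A → B → ℝ} (e : A × A × B)
    (l : List (A × A × B)) :
    penalizedVariation η ψ (e :: l) =
      (|ψ e.1 e.2.2 - ψ e.2.1 e.2.2| - η) + penalizedVariation η ψ l := by
  simp [penalizedVariation]

theorem penalizedVariation_perm {A B : Type*} {η : ℝ} {ψ : A → B → ℝ}
    {l l' : List (A × A × B)} (hl : l.Perm l') :
    penalizedVariation η ψ l = penalizedVariation η ψ l' :=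
  (hl.map _).sum_eq

theorem penalizedVariation_sub_le {A B : Type*} {η : ℝ} {ψ χ : A → B → ℝ} {δ : ℝ}
    (l : List (A × A × B))
    (h : ∀ e ∈ l, |χ e.1 e.2.2 - ψ e.1 e.2.2| ≤ δ ∧ |χ e.2.1 e.2.2 - ψ e.2.1 e.2.2| ≤ δ) :
    penalizedVariation η ψ l - 2 * δ * l.length ≤ penalizedVariation η χ l := by
  induction l with
  | nil => simp [penalizedVariation]
  | cons e l ih =>
    have ih := ih fun e' he' => h e' (List.mem_cons_of_mem _ he')
    obtain ⟨h1, h2⟩ := h e List.mem_cons_self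
    rw [penalizedVariation_cons, penalizedVariation_cons, List.length_cons]
    push_cast
    have h3 : |ψ e.1 e.2.2 - ψ e.2.1 e.2.2| ≤ |χ e.1 e.2.2 - χ e.2.1 e.2.2| + δ + δ := by
      rw [abs_le] at h1 h2 ⊢
      have h5 := abs_le.1 (le_refl |χ e.1 e.2.2 - χ e.2.1 e.2.2|)
      constructor <;> linarith
    linarith

section Variation

variable {A B : Type*} [LinearOrder A] {η : ℝ} {ψ : A → B → ℝ}

theorem IsIntervalSystem.tail {e : A × A × B} {l : List (A × A × B)}
    (h : IsIntervalSystem (e :: l)) : IsIntervalSystem l :=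
  ⟨fun e' he' => h.le e' (List.mem_cons_of_mem _ he'), (List.pairwise_cons.1 h.disjoint).2⟩

theorem IsIntervalSystem.cons {e : A × A × B} {l : List (A × A × B)} (h : IsIntervalSystem l)
    (he : e.1 ≤ e.2.1) (hd : ∀ e' ∈ l, e.2.1 ≤ e'.1 ∨ e'.2.1 ≤ e.1) :
    IsIntervalSystem (e :: l) :=
  ⟨by simpa using ⟨he, fun a b c hc => h.le _ hc⟩, List.pairwise_cons.2 ⟨hd, h.disjoint⟩⟩

theorem IsIntervalSystem.perm {l l' : List (A × A × B)} (h : IsIntervalSystem l)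
    (hl : l.Perm l') : IsIntervalSystem l' :=
  ⟨fun e he => h.le e (hl.mem_iff.2 he),
    (hl.pairwise_iff fun {_ _} h => h.symm).1 h.disjoint⟩

/-- Intervals on which `ψ` varies by at least `η` contain right ends of cells, and distinct
intervals contain distinct ones. -/
theorem penalizedVariation_le {M : ℝ} (hM : ∀ x y, |ψ x y| ≤ M) (hM0 : 0 ≤ M) (hη : 0 ≤ η)
    {F : Finset A}
    (hF : ∀ w, ∃ u ∈ F, ∃ v ∈ F, u ≤ w ∧ w ≤ v ∧
      ∀ x ∈ Set.Icc u v, ∀ x' ∈ Set.Icc u v, ∀ y, |ψ x y - ψ x' y| < η)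
    {l : List (A × A × B)} (hl : IsIntervalSystem l) :
    penalizedVariation η ψ l ≤
      2 * M * (F.filter fun c => ∃ e ∈ l, e.1 ≤ c ∧ c < e.2.1).card := by
  classical
  induction l with
  | nil => simp [penalizedVariation]
  | cons e l ih =>
    have ih := ih hl.tail
    have hsub : (F.filter fun c => ∃ e ∈ l, e.1 ≤ c ∧ c < e.2.1) ⊆
        F.filter fun c => ∃ e' ∈ e :: l, e'.1 ≤ c ∧ c < e'.2.1 := by
      intro c hc
      simp only [Finset.mem_filter] at hc ⊢
      obtain ⟨hc, e', he', h⟩ := hc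
      exact ⟨hc, e', List.mem_cons_of_mem _ he', h⟩
    rw [penalizedVariation_cons]
    obtain ⟨u, -, v, hv, huw, hwv, huv⟩ := hF e.1
    have hle := hl.le e List.mem_cons_self
    rcases le_or_gt e.2.1 v with h | h
    · have h1 := huv e.1 ⟨huw, hwv⟩ e.2.1 ⟨huw.trans hle, h⟩ e.2.2
      have h2 : (((F.filter fun c => ∃ e ∈ l, e.1 ≤ c ∧ c < e.2.1).card : ℕ) : ℝ) ≤
          (F.filter fun c => ∃ e' ∈ e :: l, e'.1 ≤ c ∧ c < e'.2.1).card := by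
        exact_mod_cast Finset.card_le_card hsub
      nlinarith
    · have hnot : v ∉ F.filter fun c => ∃ e ∈ l, e.1 ≤ c ∧ c < e.2.1 := by
        simp only [Finset.mem_filter, not_and, not_exists]
        intro _ e' he' h1
        rcases (List.pairwise_cons.1 hl.disjoint).1 e' he' with h2 | h2
        · exact absurd (h2.trans h1) (not_le.2 h)
        · exact not_lt.2 (h2.trans hwv)
      have h2 : (((F.filter fun c => ∃ e ∈ l, e.1 ≤ c ∧ c < e.2.1).card : ℕ) : ℝ) + 1 ≤
          (F.filter fun c => ∃ e' ∈ e :: l, e'.1 ≤ c ∧ c < e'.2.1).card := by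
        have := Finset.card_le_card (s := insert v _)
          (Finset.insert_subset (Finset.mem_filter.2
            ⟨hv, e, List.mem_cons_self, hwv, h⟩) hsub)
        rw [Finset.card_insert_of_notMem hnot] at this
        exact_mod_cast this
      have h3 := abs_sub (ψ e.1 e.2.2) (ψ e.2.1 e.2.2)
      have h4 := hM e.1 e.2.2
      have h5 := hM e.2.1 e.2.2
      nlinarith

theorem IsTame.bddAbove (h : IsTame η ψ) (hη : 0 ≤ η) :
    BddAbove {s | ∃ l : List (A × A × B), IsIntervalSystem l ∧ s = penalizedVariation η ψ l} := by
  obtain ⟨M, hM⟩ := h.bounded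
  obtain ⟨F, hF⟩ := h.cells
  refine ⟨2 * |M| * F.card, ?_⟩
  rintro _ ⟨l, hl, rfl⟩
  refine (penalizedVariation_le (fun x y => (hM x y).trans (le_abs_self M)) (abs_nonneg M) hη hF
    hl).trans ?_
  gcongr
  exact Finset.filter_subset _ _

theorem IsTame.penalizedVariation_le_max (h : IsTame η ψ) (hη : 0 ≤ η) {l : List (A × A × B)}
    (hl : IsIntervalSystem l) : penalizedVariation η ψ l ≤ maxVariation η ψ :=
  le_csSup (h.bddAbove hη) ⟨l, hl, rfl⟩

theorem exists_penalizedVariation_gt (ψ : A → B → ℝ) (hη : 0 < η) :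
    ∃ l : List (A × A × B), IsIntervalSystem l ∧
      maxVariation η ψ - η < penalizedVariation η ψ l := by
  obtain ⟨_, ⟨l, hl, rfl⟩, h⟩ := exists_lt_of_lt_csSup
    (s := {s | ∃ l : List (A × A × B), IsIntervalSystem l ∧ s = penalizedVariation η ψ l})
    ⟨0, [], ⟨by simp, by simp⟩, by simp [penalizedVariation]⟩
    (show maxVariation η ψ - η < maxVariation η ψ by linarith)
  exact ⟨l, hl, h⟩

/-- Inserting the interval `[u, w]` into an interval system none of whose end points lie strictly
between `u` and `v`. -/
theorem exists_insert_interval {χ : A → B → ℝ} {η c : ℝ} (hη : 0 ≤ η) {l : List (A × A × B)}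
    (hl : IsIntervalSystem l) {u v w : A} (huw : u ≤ w) (hwv : w ≤ v)
    (hends : ∀ e ∈ l, (e.1 ≤ u ∨ v ≤ e.1) ∧ (e.2.1 ≤ u ∨ v ≤ e.2.1))
    (hc0 : 0 ≤ c) (hc : ∀ e ∈ l, |χ u e.2.2 - χ v e.2.2| ≤ c) (y : B) :
    ∃ l' : List (A × A × B), IsIntervalSystem l' ∧
      penalizedVariation η χ l + |χ u y - χ w y| - c - 2 * η ≤ penalizedVariation η χ l' := by
  classical
  have huv := huw.trans hwv
  by_cases h : ∃ e ∈ l, e.1 ≤ u ∧ v ≤ e.2.1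
  · obtain ⟨e, he, heu, hve⟩ := h
    have hp := List.perm_cons_erase he
    have hs := hl.perm hp
    have hd := (List.pairwise_cons.1 hs.disjoint).1
    refine ⟨(e.1, u, e.2.2) :: (u, w, y) :: (v, e.2.1, e.2.2) :: l.erase e, ?_, ?_⟩
    · refine ((hs.tail.cons hve fun e' he' => ?_).cons huw ?_).cons heu ?_
      · exact (hd e' he').imp id fun h => h.trans (heu.trans huv)
      · simp only [List.mem_cons, forall_eq_or_imp]
        exact ⟨.inl hwv, fun e' he' => (hd e' he').imp (fun h => hwv.trans (hve.trans h))
          fun h => h.trans heu⟩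
      · simp only [List.mem_cons, forall_eq_or_imp]
        exact ⟨.inl le_rfl, .inl huv, fun e' he' =>
          (hd e' he').imp (fun h => huv.trans (hve.trans h)) id⟩
    · rw [penalizedVariation_perm hp]
      simp only [penalizedVariation_cons]
      have h1 := hc e he
      have h2 := abs_sub_le (χ e.1 e.2.2) (χ u e.2.2) (χ e.2.1 e.2.2)
      have h3 := abs_sub_le (χ u e.2.2) (χ v e.2.2) (χ e.2.1 e.2.2)
      linarith
  · refine ⟨(u, w, y) :: l, hl.cons huw fun e he => ?_, ?_⟩
    · obtain ⟨h1, h2⟩ := hends e he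
      rcases h1 with h1 | h1
      · rcases h2 with h2 | h2
        · exact .inr h2
        · exact absurd ⟨e, he, h1, h2⟩ h
      · exact .inl (hwv.trans h1)
    · rw [penalizedVariation_cons]
      simp only
      linarith

theorem IsTame.exists_finset (hη : 0 < η) (hψ : IsTame η ψ) :
    ∃ F : Finset A, ∃ E : Finset (A × B), ∃ δ > 0, ∀ χ : A → B → ℝ, IsTame η χ →
      ⌊maxVariation η χ / η⌋ = ⌊maxVariation η ψ / η⌋ →
      (∀ p ∈ E, |χ p.1 p.2 - ψ p.1 p.2| < δ) →
      ∀ w, ∃ u ∈ F, ∀ y, |χ u y - χ w y| < 9 * η ∧ |ψ u y - ψ w y| < 9 * η := by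
  classical
  obtain ⟨F₀, hF₀⟩ := hψ.cells
  obtain ⟨l, hl, hlW⟩ := exists_penalizedVariation_gt ψ hη
  set F : Finset A := F₀ ∪ (l.map fun e => e.1).toFinset ∪ (l.map fun e => e.2.1).toFinset with hF
  set R : Finset B := (l.map fun e => e.2.2).toFinset with hR
  have hF1 : ∀ e ∈ l, e.1 ∈ F := fun e he => by
    simp only [hF, Finset.mem_union, List.mem_toFinset, List.mem_map]
    exact .inl (.inr ⟨e, he, rfl⟩)
  have hF2 : ∀ e ∈ l, e.2.1 ∈ F := fun e he => by
    simp only [hF, Finset.mem_union, List.mem_toFinset, List.mem_map]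
    exact .inr ⟨e, he, rfl⟩
  have hR1 : ∀ e ∈ l, e.2.2 ∈ R := fun e he => by
    simp only [hR, List.mem_toFinset, List.mem_map]
    exact ⟨e, he, rfl⟩
  set δ : ℝ := η / (2 * (l.length + 1)) with hδ
  have hδ0 : 0 < δ := by positivity
  have hδl : 2 * δ * l.length + 2 * δ = η := by rw [hδ]; field_simp
  have hl0 : (0 : ℝ) ≤ 2 * δ * l.length := by positivity
  refine ⟨F, F ×ˢ R, δ, hδ0, fun χ hχ hfloor hclose w => ?_⟩
  obtain ⟨u₀, hu₀, v₀, hv₀, hu₀w, hwv₀, hosc⟩ := hF₀ w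
  have hsub : F₀ ⊆ F := Finset.subset_union_left.trans Finset.subset_union_left
  obtain ⟨u, hu, humax⟩ := (F.filter (· ≤ w)).exists_max_image id
    ⟨u₀, Finset.mem_filter.2 ⟨hsub hu₀, hu₀w⟩⟩
  obtain ⟨v, hv, hvmin⟩ := (F.filter (w ≤ ·)).exists_min_image id
    ⟨v₀, Finset.mem_filter.2 ⟨hsub hv₀, hwv₀⟩⟩
  simp only [Finset.mem_filter, id] at hu humax hv hvmin
  have hsplit : ∀ a ∈ F, a ≤ u ∨ v ≤ a := fun a ha =>
    (le_total a w).imp (fun h => humax a ⟨ha, h⟩) fun h => hvmin a ⟨ha, h⟩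
  have hu₀u := humax u₀ ⟨hsub hu₀, hu₀w⟩
  have hvv₀ := hvmin v₀ ⟨hsub hv₀, hwv₀⟩
  have hc : ∀ e ∈ l, |χ u e.2.2 - χ v e.2.2| ≤ 2 * η := by
    intro e he
    have h1 := hosc u ⟨hu₀u, hu.2.trans hwv₀⟩ v ⟨hu₀w.trans hv.2, hvv₀⟩ e.2.2
    have h2 := hclose (u, e.2.2) (Finset.mk_mem_product hu.1 (hR1 e he))
    have h3 := hclose (v, e.2.2) (Finset.mk_mem_product hv.1 (hR1 e he))
    simp only [abs_lt] at h1 h2 h3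
    rw [abs_le]
    constructor <;> linarith
  have hval := penalizedVariation_sub_le (η := η) (ψ := ψ) (χ := χ) (δ := δ) l fun e he =>
    ⟨(hclose (e.1, e.2.2) (Finset.mk_mem_product (hF1 e he) (hR1 e he))).le,
      (hclose (e.2.1, e.2.2) (Finset.mk_mem_product (hF2 e he) (hR1 e he))).le⟩
  have hW : maxVariation η χ < maxVariation η ψ + η := by
    have h1 := (Int.abs_sub_lt_one_of_floor_eq_floor hfloor)
    rw [← sub_div, abs_div, abs_of_pos hη, div_lt_one hη] at h1
    linarith [(abs_lt.1 h1).2]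
  refine ⟨u, hu.1, fun y => ⟨?_, ?_⟩⟩
  · obtain ⟨l', hl', h⟩ := exists_insert_interval hη.le hl hu.2 hv.2
      (fun e he => ⟨hsplit _ (hF1 e he), hsplit _ (hF2 e he)⟩) (by positivity) hc y
    have := hχ.penalizedVariation_le_max hη.le hl'
    linarith
  · have := hosc u ⟨hu₀u, hu.2.trans hwv₀⟩ w ⟨hu₀w, hwv₀⟩ y
    linarith

end Variation

theorem abs_sub_le_of_update {ι : Type*} [Fintype ι] [DecidableEq ι] {X : ι → Type*}
    (G : (∀ i, X i) → ℝ) (u w : ∀ i, X i) (C : ℝ)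
    (h : ∀ i y, |G (Function.update y i (u i)) - G (Function.update y i (w i))| ≤ C) :
    |G u - G w| ≤ Fintype.card ι * C := by
  have key : ∀ s : Finset ι, |G (s.piecewise u w) - G w| ≤ s.card * C := by
    intro s
    induction s using Finset.induction_on with
    | empty => simp
    | insert j s hj ih =>
      have h1 := h j (s.piecewise u w)
      rw [← Finset.piecewise_insert] at h1
      have h2 : Function.update (s.piecewise u w) j (w j) = s.piecewise u w := by
        rw [Function.update_eq_self_iff]; simp [hj]
      rw [h2] at h1
      rw [Finset.card_insert_of_notMem hj]
      push_cast
      linarith [abs_sub_le (G ((insert j s).piecewise u w)) (G (s.piecewise u w)) (G w)]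
  simpa using key Finset.univ

theorem exists_isClopen_isLowerSet {α : Type*} [LinearOrder α] [TopologicalSpace α]
    [OrderTopology α] [CompactSpace α] [TotallyDisconnectedSpace α] {x y : α} (hxy : x < y) :
    ∃ U : Set α, IsClopen U ∧ IsLowerSet U ∧ x ∈ U ∧ y ∉ U := by
  obtain ⟨V, hV, hxV, hyV⟩ := exists_isClopen_of_totally_separated hxy.ne
  have hcomp : IsCompact (Set.Icc x y ∩ Vᶜ) :=
    (isClosed_Icc.inter hV.compl.isClosed).isCompact
  obtain ⟨t, ⟨⟨hxt, hty⟩, htV⟩, htmin⟩ := hcomp.exists_isLeast ⟨y, ⟨hxy.le, le_rfl⟩, hyV⟩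
  have hIio : Set.Iio t = Set.Iic x ∪ (Set.Icc x t ∩ V) := by
    ext z
    simp only [Set.mem_Iio, Set.mem_union, Set.mem_Iic, Set.mem_inter_iff, Set.mem_Icc]
    constructor
    · intro hz
      refine (le_total z x).imp id fun hxz => ⟨⟨hxz, hz.le⟩, ?_⟩
      by_contra hzV
      exact hz.not_ge (htmin ⟨⟨hxz, hz.le.trans hty⟩, hzV⟩)
    · rintro (hz | ⟨⟨-, hz⟩, hzV⟩)
      · refine hz.trans_lt (hxt.lt_of_ne ?_)
        rintro rfl
        exact htV hxV
      · refine hz.lt_of_ne ?_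
        rintro rfl
        exact htV hzV
  refine ⟨Set.Iio t, ⟨?_, isOpen_Iio⟩, isLowerSet_Iio t, ?_, hty.not_gt⟩
  · rw [hIio]
    exact isClosed_Iic.union (isClosed_Icc.inter hV.isClosed)
  · refine hxt.lt_of_ne ?_
    rintro rfl
    exact htV hxV

/-- A continuous function on a compact space is determined up to `η` by finitely many members of a
point-separating family of clopen sets. -/
theorem exists_finset_clopen_determining {Z ι : Type*} [TopologicalSpace Z] [CompactSpace Z]
    {S : ι → Set Z} (hS : ∀ j, IsClopen (S j)) (hsep : ∀ z z', z ≠ z' → ∃ j, ¬(z ∈ S j ↔ z' ∈ S j))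
    {f : Z → ℝ} (hf : Continuous f) {η : ℝ} (hη : 0 < η) :
    ∃ G : Finset ι, ∀ z z', (∀ j ∈ G, z ∈ S j ↔ z' ∈ S j) → |f z - f z'| < η := by
  have hclosed : IsClosed {p : Z × Z | η ≤ |f p.1 - f p.2|} :=
    isClosed_le continuous_const (by fun_prop)
  have hopen : ∀ j, IsOpen {p : Z × Z | ¬(p.1 ∈ S j ↔ p.2 ∈ S j)} := by
    intro j
    have : {p : Z × Z | ¬(p.1 ∈ S j ↔ p.2 ∈ S j)} = S j ×ˢ (S j)ᶜ ∪ (S j)ᶜ ×ˢ S j := by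
      ext p
      simp only [Set.mem_ofPred_eq, Set.mem_union, Set.mem_prod, Set.mem_compl_iff]
      tauto
    rw [this]
    exact ((hS j).isOpen.prod (hS j).compl.isOpen).union
      ((hS j).compl.isOpen.prod (hS j).isOpen)
  obtain ⟨G, hG⟩ := hclosed.isCompact.elim_finite_subcover _ hopen fun p hp => by
    refine Set.mem_iUnion.2 (hsep p.1 p.2 fun h => ?_)
    rw [Set.mem_ofPred_eq, h, sub_self, abs_zero] at hp
    exact hp.not_gt hη
  refine ⟨G, fun z z' h => ?_⟩
  by_contra hlt
  have := hG (show (z, z') ∈ {p : Z × Z | η ≤ |f p.1 - f p.2|} from not_lt.1 hlt)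
  simp only [Set.mem_iUnion] at this
  obtain ⟨j, hj, h'⟩ := this
  exact h' (h j hj)

theorem Flag.isClosed {α : Type*} [PartialOrder α] [TopologicalSpace α] [OrderClosedTopology α]
    (s : Flag α) : IsClosed (s : Set α) := by
  have : (s : Set α) = ⋂ b ∈ s, (Set.Iic b ∪ Set.Ici b) := by
    ext a
    simp only [SetLike.mem_coe, Set.mem_iInter, Set.mem_union, Set.mem_Iic, Set.mem_Ici]
    exact Flag.mem_iff_forall_le_or_ge
  rw [this]
  exact isClosed_biInter fun b _ => isClosed_Iic.union isClosed_Ici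

/-- Finitely many clopen lower sets partition a compact chain into finitely many intervals. -/
theorem exists_finset_cells {α ι : Type*} [LinearOrder α] [TopologicalSpace α]
    [OrderClosedTopology α] [CompactSpace α] {S : ι → Set α} {G : Finset ι}
    (hS : ∀ j ∈ G, IsClopen (S j)) (hlow : ∀ j ∈ G, IsLowerSet (S j)) :
    ∃ F : Finset α, ∀ w, ∃ u ∈ F, ∃ v ∈ F, u ≤ w ∧ w ≤ v ∧
      ∀ x ∈ Set.Icc u v, ∀ x' ∈ Set.Icc u v, ∀ j ∈ G, x ∈ S j ↔ x' ∈ S j := by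
  classical
  let cell : Finset ι → Set α := fun T => {w | ∀ j ∈ G, w ∈ S j ↔ j ∈ T}
  have hcell : ∀ T, IsCompact (cell T) := by
    intro T
    have : cell T = ⋂ j ∈ G, {w | w ∈ S j ↔ j ∈ T} := by ext; simp [cell]
    rw [this]
    refine (isClosed_biInter fun j hj => ?_).isCompact
    by_cases h : j ∈ T
    · simpa [h] using (hS j hj).isClosed
    · simpa [h, Set.compl_def] using (hS j hj).compl.isClosed
  have hends : ∀ T, ∃ F : Finset α, ∀ w ∈ cell T, ∃ u ∈ F, ∃ v ∈ F,
      u ≤ w ∧ w ≤ v ∧ u ∈ cell T ∧ v ∈ cell T := by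
    intro T
    rcases (cell T).eq_empty_or_nonempty with h | h
    · exact ⟨∅, by simp [h]⟩
    · obtain ⟨u, hu, humin⟩ := (hcell T).exists_isLeast h
      obtain ⟨v, hv, hvmax⟩ := (hcell T).exists_isGreatest h
      exact ⟨{u, v}, fun w hw => ⟨u, by simp, v, by simp, humin hw, hvmax hw, hu, hv⟩⟩
  choose F hF using hends
  refine ⟨G.powerset.biUnion F, fun w => ?_⟩
  have hw : w ∈ cell (G.filter fun j => w ∈ S j) := by
    intro j hj
    simp [hj]
  have hmem : G.filter (fun j => w ∈ S j) ∈ G.powerset :=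
    Finset.mem_powerset.2 (Finset.filter_subset _ _)
  obtain ⟨u, hu, v, hv, huw, hwv, hu', hv'⟩ := hF _ w hw
  refine ⟨u, Finset.mem_biUnion.2 ⟨_, hmem, hu⟩, v, Finset.mem_biUnion.2 ⟨_, hmem, hv⟩,
    huw, hwv, ?_⟩
  have key : ∀ x ∈ Set.Icc u v, ∀ j ∈ G, x ∈ S j ↔ w ∈ S j := fun x hx j hj =>
    ⟨fun h => ((hu' j hj).trans (hw j hj).symm).1 (hlow j hj hx.1 h),
      fun h => hlow j hj hx.2 (((hv' j hj).trans (hw j hj).symm).2 h)⟩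
  exact fun x hx x' hx' j hj => (key x hx j hj).trans (key x' hx' j hj).symm

section Sublattice

variable {n : ℕ} {L : Fin n → Type*} [∀ i, LinearOrder (L i)]

theorem sup'_apply_mem_iff [NeZero n] (c : Fin n → ∀ i, L i) {l : Fin n} {U : Set (L l)}
    (hU : IsLowerSet U) : Finset.univ.sup' Finset.univ_nonempty c l ∈ U ↔ ∀ i, c i l ∈ U := by
  rw [Finset.sup'_apply]
  constructor
  · intro h i
    exact hU (Finset.le_sup' (fun i => c i l) (Finset.mem_univ i)) h
  · intro h
    obtain ⟨i, -, hi⟩ := Finset.exists_mem_eq_sup' Finset.univ_nonempty fun i => c i l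
    rw [hi]
    exact h i

variable [∀ i, TopologicalSpace (L i)] [∀ i, OrderTopology (L i)] [∀ i, CompactSpace (L i)]

theorem exists_isLeast_of_inf_mem [NeZero n] {S : Set (∀ i, L i)} (hS : IsClosed S)
    (hne : S.Nonempty) (hinf : ∀ x ∈ S, ∀ y ∈ S, x ⊓ y ∈ S) : ∃ m, IsLeast S m := by
  have h : ∀ l, ∃ m ∈ S, ∀ z ∈ S, m l ≤ z l := fun l => by
    obtain ⟨m, hm, h⟩ := hS.isCompact.exists_isMinOn hne (continuous_apply l).continuousOn
    exact ⟨m, hm, fun z hz => h hz⟩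
  choose m hm hle using h
  refine ⟨Finset.univ.inf' Finset.univ_nonempty m,
    Finset.inf'_mem _ hinf _ _ _ fun i _ => hm i, fun z hz l => ?_⟩
  exact (Finset.inf'_le m (Finset.mem_univ l) l).trans (hle l z hz)

/-- A closed sublattice of a product of `n` compact chains is generated under joins by `n` of its
maximal chains. -/
theorem exists_flags_sup_eq [NeZero n] {K : Set (∀ i, L i)} (hK : IsClosed K)
    (hinf : ∀ x ∈ K, ∀ y ∈ K, x ⊓ y ∈ K) :
    ∃ C : Fin n → Flag K, ∀ z : K, ∃ c : ∀ i, C i,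
      Finset.univ.sup' Finset.univ_nonempty (fun i => ((c i : K) : ∀ i, L i)) = z := by
  have hm : ∀ (i : Fin n) (z : K), ∃ m, IsLeast {x | x ∈ K ∧ z.1 i ≤ x i} m := by
    intro i z
    refine exists_isLeast_of_inf_mem (hK.inter (isClosed_le continuous_const
      (continuous_apply i))) ⟨z.1, z.2, le_rfl⟩ ?_
    rintro x ⟨hx, hx'⟩ y ⟨hy, hy'⟩
    exact ⟨hinf x hx y hy, le_inf hx' hy'⟩
  choose m hm using hm
  have hchain : ∀ i, IsChain (· ≤ ·) (Set.range fun z : K => (⟨m i z, (hm i z).1.1⟩ : K)) := by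
    rintro i _ ⟨z, rfl⟩ _ ⟨z', rfl⟩ -
    exact (le_total (z.1 i) (z'.1 i)).imp
      (fun h => (hm i z).2 ⟨(hm i z').1.1, h.trans (hm i z').1.2⟩)
      (fun h => (hm i z').2 ⟨(hm i z).1.1, h.trans (hm i z).1.2⟩)
  choose M hM hsub using fun i => IsChain.exists_maxChain (hchain i)
  refine ⟨fun i => Flag.ofIsMaxChain (M i) (hM i), fun z =>
    ⟨fun i => ⟨⟨m i z, (hm i z).1.1⟩, hsub i ⟨z, rfl⟩⟩, le_antisymm ?_ fun l => ?_⟩⟩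
  · exact Finset.sup'_le _ _ fun i _ => (hm i z).2 ⟨z.2, le_rfl⟩
  · exact (hm l z).1.2.trans (Finset.le_sup' (fun i => m i z) (Finset.mem_univ l) l)

open Classical in
/-- Along each of the chains, a continuous function on `K` is tame after composition with the join
map. -/
theorem isTame_comp_sup [∀ i, TotallyDisconnectedSpace (L i)] [NeZero n] {K : Set (∀ i, L i)}
    (hK : IsClosed K) {C : Fin n → Flag K} {q : (∀ i, C i) → K}
    (hq : ∀ c, (q c : ∀ i, L i) =
      Finset.univ.sup' Finset.univ_nonempty fun i => ((c i : K) : ∀ i, L i))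
    {f : K → ℝ} (hf : Continuous f) {η : ℝ} (hη : 0 < η) (i : Fin n) :
    IsTame η fun (x : C i) (y : ∀ i, C i) => f (q (Function.update y i x)) := by
  have : CompactSpace K := isCompact_iff_compactSpace.1 hK.isCompact
  have : CompactSpace (C i) := isCompact_iff_compactSpace.1 (C i).isClosed.isCompact
  have : OrderClosedTopology (C i) :=
    ⟨(OrderClosedTopology.isClosed_le' (α := K)).preimage
      (continuous_subtype_val.prodMap continuous_subtype_val)⟩
  obtain ⟨M, hM⟩ := isCompact_univ.exists_bound_of_continuousOn hf.continuousOn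
  refine ⟨⟨M, fun x y => hM _ trivial⟩, ?_⟩
  let S : (Σ l, {U : Set (L l) // IsClopen U ∧ IsLowerSet U}) → Set K :=
    fun j => {z | z.1 j.1 ∈ j.2.1}
  have hS : ∀ j, IsClopen (S j) := fun j =>
    j.2.2.1.preimage ((continuous_apply j.1).comp continuous_subtype_val)
  have hsep : ∀ z z' : K, z ≠ z' → ∃ j, ¬(z ∈ S j ↔ z' ∈ S j) := by
    intro z z' hne
    obtain ⟨l, hl⟩ := Function.ne_iff.1 (Subtype.coe_ne_coe.2 hne)
    rcases lt_or_gt_of_ne hl with h | h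
    · obtain ⟨U, hU, hU', hz, hz'⟩ := exists_isClopen_isLowerSet h
      exact ⟨⟨l, U, hU, hU'⟩, fun h => hz' (h.1 hz)⟩
    · obtain ⟨U, hU, hU', hz, hz'⟩ := exists_isClopen_isLowerSet h
      exact ⟨⟨l, U, hU, hU'⟩, fun h => hz' (h.2 hz)⟩
  obtain ⟨G, hG⟩ := exists_finset_clopen_determining hS hsep hf hη
  obtain ⟨F, hF⟩ := exists_finset_cells (α := C i) (G := G) (S := fun j => {x | (x : K) ∈ S j})
    (fun j _ => (hS j).preimage continuous_subtype_val)
    (fun j _ a b hba ha => j.2.2.2 (show (b : K).1 j.1 ≤ (a : K).1 j.1 from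
      (show ((b : K) : ∀ i, L i) ≤ (a : K) from hba) j.1) ha)
  refine ⟨F, fun w => ?_⟩
  obtain ⟨u, hu, v, hv, huw, hwv, huv⟩ := hF w
  refine ⟨u, hu, v, hv, huw, hwv, fun x hx x' hx' y => hG _ _ fun j hj => ?_⟩
  change (q _).1 j.1 ∈ j.2.1 ↔ (q _).1 j.1 ∈ j.2.1
  rw [hq, hq, sup'_apply_mem_iff _ j.2.2.2, sup'_apply_mem_iff _ j.2.2.2]
  refine forall_congr' fun k => ?_
  rcases eq_or_ne k i with rfl | hk
  · simpa [S] using huv x hx x' hx' j hj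
  · simp [hk]

end Sublattice

/-- Let `L₁, …, Lₙ` be nonempty compact totally disconnected linearly ordered
topological spaces with their order topologies and let `K` be a closed sublattice
of their product (with coordinatewise order and product topology). Then `C(K)`,
with the topology of pointwise convergence, has a countable cover by sets of small
local norm-diameter: for every `ε > 0` there are sets `X m` covering `C(K)` such
that every `f ∈ X m` has a pointwise-open neighborhood (determined by a finite set
`F ⊆ K` and `δ > 0`) whose intersection with `X m` has norm-diameter at most `ε`. -/
theorem stmt11 {n : ℕ} {L : Fin n → Type*}
    [∀ i, LinearOrder (L i)] [∀ i, TopologicalSpace (L i)] [∀ i, OrderTopology (L i)]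
    [∀ i, CompactSpace (L i)] [∀ i, TotallyDisconnectedSpace (L i)]
    [∀ i, Nonempty (L i)]
    (K : Set (∀ i, L i)) (hKclosed : IsClosed K)
    (hKmeet : ∀ x ∈ K, ∀ y ∈ K, x ⊓ y ∈ K) (hKjoin : ∀ x ∈ K, ∀ y ∈ K, x ⊔ y ∈ K)
    (ε : ℝ) (hε : 0 < ε) :
    ∃ X : ℕ → Set {f : K → ℝ // Continuous f},
      (⋃ m, X m) = Set.univ ∧
      ∀ m : ℕ, ∀ f ∈ X m, ∃ F : Finset K, ∃ δ > (0 : ℝ),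
        ∀ g ∈ X m, ∀ h ∈ X m,
          (∀ x ∈ F, |g.1 x - f.1 x| < δ) → (∀ x ∈ F, |h.1 x - f.1 x| < δ) →
          ∀ x : K, |g.1 x - h.1 x| < ε := by
  classical
  rcases Nat.eq_zero_or_pos n with rfl | hn
  · refine ⟨fun _ => Set.univ, Set.iUnion_const _, fun _ f _ =>
      ⟨Set.toFinite Set.univ |>.toFinset, ε / 2, half_pos hε, fun g _ h _ hg hh x => ?_⟩⟩
    have h1 := abs_lt.1 (hg x (by simp))
    have h2 := abs_lt.1 (hh x (by simp))
    rw [abs_lt]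
    constructor <;> linarith
  have : NeZero n := ⟨hn.ne'⟩
  obtain ⟨C, hC⟩ := exists_flags_sup_eq hKclosed hKmeet
  let q : (∀ i, C i) → K := fun c =>
    ⟨Finset.univ.sup' Finset.univ_nonempty fun i => ((c i : K) : ∀ i, L i),
      Finset.sup'_mem _ hKjoin _ _ _ fun i _ => (c i : K).2⟩
  have hq : Function.Surjective q := fun z => (hC z).imp fun c hc => Subtype.ext hc
  obtain ⟨η, hη, hηε⟩ : ∃ η > 0, 2 * ((18 * n + 1) * η) = ε :=
    ⟨ε / (2 * (18 * n + 1)), by positivity, by field_simp⟩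
  let ψ : (K → ℝ) → ∀ i, C i → (∀ i, C i) → ℝ := fun f i x y => f (q (Function.update y i x))
  have htame : ∀ (f : {f : K → ℝ // Continuous f}) i, IsTame η (ψ f.1 i) := fun f i =>
    isTame_comp_sup hKclosed (fun _ => rfl) f.2 hη i
  let code : {f : K → ℝ // Continuous f} → Fin n → ℤ := fun f i =>
    ⌊maxVariation η (ψ f.1 i) / η⌋
  obtain ⟨enc, henc⟩ := exists_injective_nat (Fin n → ℤ)
  refine ⟨fun m => {f | enc (code f) = m}, Set.eq_univ_of_forall fun f =>
    Set.mem_iUnion.2 ⟨_, rfl⟩, ?_⟩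
  rintro _ f rfl
  choose F E δ hδ hFE using fun i => (htame f i).exists_finset hη
  let P : Finset K := (Fintype.piFinset F).image q ∪
    Finset.univ.biUnion fun i => (E i).image fun p => q (Function.update p.2 i p.1)
  let δ₀ := min η (Finset.univ.inf' Finset.univ_nonempty δ)
  have hnear : ∀ g ∈ {g | enc (code g) = enc (code f)}, (∀ x ∈ P, |g.1 x - f.1 x| < δ₀) →
      ∀ x, |g.1 x - f.1 x| < (18 * n + 1) * η := by
    intro g hg hgP x
    obtain ⟨w, rfl⟩ := hq x
    have hu := fun i => hFE i (ψ g.1 i) (htame g i) (congrFun (henc hg) i) (fun p hp =>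
      (hgP (q (Function.update p.2 i p.1)) (Finset.mem_union_right _ (Finset.mem_biUnion.2
        ⟨i, Finset.mem_univ i, Finset.mem_image_of_mem _ hp⟩))).trans_le
        ((min_le_right _ _).trans (Finset.inf'_le δ (Finset.mem_univ i)))) (w i)
    choose u huF hu using hu
    have h1 := abs_sub_le_of_update (fun c => g.1 (q c)) u w (9 * η) fun i y => (hu i y).1.le
    have h2 := abs_sub_le_of_update (fun c => f.1 (q c)) u w (9 * η) fun i y => (hu i y).2.le
    have h3 := (hgP (q u) (Finset.mem_union_left _ (Finset.mem_image_of_mem _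
      (Fintype.mem_piFinset.2 huF)))).trans_le (min_le_left _ _)
    rw [Fintype.card_fin, abs_le] at h1 h2
    rw [abs_lt] at h3 ⊢
    constructor <;> linarith
  refine ⟨P, δ₀, lt_min hη ((Finset.lt_inf'_iff _).2 fun i _ => hδ i),
    fun g hg h hh hgP hhP x => ?_⟩
  have h1 := abs_lt.1 (hnear g hg hgP x)
  have h2 := abs_lt.1 (hnear h hh hhP x)
  rw [abs_lt]
  constructor <;> linarith
end
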